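/- arXiv:1401.3702 — 5 statements merged into one kernel-verified Lean document; each statement's English description precedes it below -/
import Mathlib

section
/- Let q = 2^n, and let ℓ ≥ 2 and r ≥ 0 be integers such that ℓ/u is odd, where u = gcd(ℓ, r) (with u = ℓ when r = 0). Let b, c ∈ F_{q^ℓ} and let T_u : F_{q^ℓ} → F_{q^u} be the trace map. If T_u(b) is not a nonzero element of F_q (i.e., T_u(b) = 0 or T_u(b) ∉ F_q), then N_{ℓ,r}(1, b, c) = q^ℓ. -/
/-- The additive map `z ↦ z ^ (p ^ n) - z`. -/
def artinSchreierHom (F : Type*) [Field F] (p : ℕ) [Fact p.Prime] [CharP F p] (n : ℕ) : F →+ F :=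
  (iterateFrobenius F p n : F →+ F) - AddMonoidHom.id F

section

variable {F : Type*} [Field F] {p : ℕ} [Fact p.Prime] [CharP F p] {n : ℕ}

theorem artinSchreierHom_apply (z : F) :
    artinSchreierHom F p n z = z ^ p ^ n - z := by
  simp [artinSchreierHom, iterateFrobenius_def]

theorem pow_pow_sub_mem_range_artinSchreierHom (s : F) (i : ℕ) :
    s ^ (p ^ n) ^ i - s ∈ (artinSchreierHom F p n).range := by
  induction i with
  | zero => simp
  | succ i ih =>
    have h : (s ^ (p ^ n) ^ i) ^ p ^ n - s ^ (p ^ n) ^ i ∈ (artinSchreierHom F p n).range :=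
      ⟨_, artinSchreierHom_apply _⟩
    simpa [pow_succ, pow_mul] using add_mem h ih

/-- If translating the argument of `g` by a suitable element changes `g`, modulo the
Artin-Schreier image, by any prescribed constant, then `y ^ q - y = g x + c` has
`card F` solutions. -/
theorem card_artinSchreier_eq_of_translate [Fintype F] (g : F → F)
    (hg : ∀ d : F, ∃ w : F, ∀ x, g (x + w) - g x - d ∈ (artinSchreierHom F p n).range) (c : F) :
    Nat.card {xy : F × F // xy.2 ^ p ^ n - xy.2 = g xy.1 + c} = Fintype.card F := by
  have hle : ∀ c c' : F, Nat.card {xy : F × F // xy.2 ^ p ^ n - xy.2 = g xy.1 + c} ≤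
      Nat.card {xy : F × F // xy.2 ^ p ^ n - xy.2 = g xy.1 + c'} := by
    intro c c'
    obtain ⟨w, hw⟩ := hg (c - c')
    choose z hz using hw
    refine Nat.card_le_card_of_injective
      (fun t => ⟨(t.1.1 + w, t.1.2 + z t.1.1), ?_⟩) ?_
    · have h₁ := t.2
      have h₂ := hz t.1.1
      rw [artinSchreierHom_apply] at h₂
      simp only [add_pow_char_pow]
      linear_combination h₁ + h₂
    · rintro ⟨⟨x, y⟩, h⟩ ⟨⟨x', y'⟩, h'⟩ e
      simp only [Subtype.mk.injEq, Prod.mk.injEq, add_left_inj] at e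
      obtain ⟨rfl, e⟩ := e
      simpa using e
  have hsum : Nat.card (F × F) =
      ∑ d : F, Nat.card {xy : F × F // xy.2 ^ p ^ n - xy.2 = g xy.1 + d} := by
    rw [← Nat.card_sigma]
    refine Nat.card_congr ((Equiv.sigmaFiberEquiv
      (fun xy : F × F => xy.2 ^ p ^ n - xy.2 - g xy.1)).symm.trans
      (Equiv.sigmaCongrRight fun d => Equiv.subtypeEquivRight fun xy => ?_))
    rw [sub_eq_iff_eq_add']
  rw [Finset.sum_congr rfl fun d _ => (hle d c).antisymm (hle c d)] at hsum
  simpa [Nat.card_eq_fintype_card, Fintype.card_ne_zero] using hsum.symm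

end

section

variable {F : Type*} [Field F] [CharP F 2] {n : ℕ}

theorem sum_pow_sub_mem_range_artinSchreierHom (u : ℕ) {m : ℕ} (hm : Odd m) (z : F) :
    ∑ i ∈ Finset.range m, z ^ (2 ^ n) ^ (u * i) - z ∈ (artinSchreierHom F 2 n).range := by
  have h : ∑ i ∈ Finset.range m, (z ^ (2 ^ n) ^ (u * i) - z) ∈ (artinSchreierHom F 2 n).range :=
    sum_mem fun i _ => pow_pow_sub_mem_range_artinSchreierHom z (u * i)
  have hm' : (m : F) = 1 := by
    obtain ⟨k, rfl⟩ := hm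
    simp [CharTwo.two_eq_zero]
  simpa [Finset.sum_sub_distrib, hm'] using h

theorem sum_pow_pow_eq_self {u m : ℕ} {z : F} (hz : z ^ (2 ^ n) ^ (u * m) = z) :
    (∑ i ∈ Finset.range m, z ^ (2 ^ n) ^ (u * i)) ^ (2 ^ n) ^ u =
      ∑ i ∈ Finset.range m, z ^ (2 ^ n) ^ (u * i) := by
  have h := Finset.sum_range_succ (fun i => z ^ (2 ^ n) ^ (u * i)) m
  rw [Finset.sum_range_succ'] at h
  simp only [hz, mul_zero, pow_zero, pow_one, add_left_inj] at h
  rw [← pow_mul 2 n u, sum_pow_char_pow]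
  refine Eq.trans ?_ h
  refine Finset.sum_congr rfl fun i _ => ?_
  rw [← pow_mul, pow_mul 2 n u, ← pow_add, mul_add, mul_one]

/-- Every `e` fixed by the `u`-th power of `q`-Frobenius is of the form `w ^ 2 + T * w` modulo
the Artin-Schreier image, with `w` fixed as well. -/
theorem exists_sq_add_mul_sub_mem_range_artinSchreierHom [Finite F] {u : ℕ} {T e : F}
    (hT : T ^ (2 ^ n) ^ u = T) (he : e ^ (2 ^ n) ^ u = e) (h : T = 0 ∨ T ^ 2 ^ n ≠ T) :
    ∃ w : F, w ^ (2 ^ n) ^ u = w ∧ w ^ 2 + T * w - e ∈ (artinSchreierHom F 2 n).range := by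
  have root : ∀ (k : ℕ) (a : F), a ^ (2 ^ n) ^ u = a →
      ∃ v : F, v ^ (2 ^ n) ^ u = v ∧ v ^ 2 ^ k = a := by
    intro k a ha
    have hinj : Function.Injective fun x : F => x ^ 2 ^ k := iterateFrobenius_inj F 2 k
    obtain ⟨v, hv⟩ := Finite.surjective_of_injective hinj a
    dsimp only at hv
    refine ⟨v, hinj ?_, hv⟩
    dsimp only
    rw [← pow_mul, mul_comm, pow_mul, hv, ha]
  rcases h with rfl | h
  · obtain ⟨w, hw, hwe⟩ := root 1 e he
    exact ⟨w, hw, by simp_all⟩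
  · have hne : T - T ^ 2 ^ n ≠ 0 := sub_ne_zero.mpr (Ne.symm h)
    have hfix : (e / (T - T ^ 2 ^ n)) ^ (2 ^ n) ^ u = e / (T - T ^ 2 ^ n) := by
      rw [div_pow, he, ← pow_mul 2 n u, sub_pow_char_pow, pow_mul 2 n u, hT, ← pow_mul,
        mul_comm, pow_mul, hT]
    obtain ⟨v, hv, hve⟩ := root n _ hfix
    refine ⟨v ^ 2 ^ n - v, ?_, v ^ 2 + T * v, ?_⟩
    · rw [← pow_mul 2 n u, sub_pow_char_pow, pow_mul 2 n u, hv, ← pow_mul, mul_comm, pow_mul, hv]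
    · rw [eq_div_iff hne] at hve
      rw [artinSchreierHom_apply, add_pow_char_pow, mul_pow, ← pow_mul, mul_comm 2, pow_mul]
      linear_combination (-hve) + (v ^ 2 ^ n * v - v ^ 2) * CharTwo.two_eq_zero (R := F)

end

/-- Let `q = 2 ^ n`, `ℓ ≥ 2`, `r ≥ 0` with `ℓ / u` odd where `u = gcd(ℓ, r)`.
Let `b, c ∈ F_{q^ℓ}` and let `T_u : F_{q^ℓ} → F_{q^u}` be the trace map.  If `T_u(b)` is not a
nonzero element of `F_q` (i.e. `T_u(b) = 0` or `T_u(b) ∉ F_q`, the latter expressed as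
`T_u(b)^q ≠ T_u(b)`), then `N_{ℓ,r}(1, b, c) = q ^ ℓ`. -/
theorem stmt_3 (n : ℕ) (hn : 1 ≤ n) (q : ℕ) (hq : q = 2 ^ n)
    (ℓ r : ℕ) (hℓ : 2 ≤ ℓ) (u : ℕ) (hu : u = Nat.gcd ℓ r) (hodd : Odd (ℓ / u))
    (F : Type) [Field F] [Fintype F] (hF : Fintype.card F = q ^ ℓ)
    (Tu : F → F) (hTu : ∀ z : F, Tu z = ∑ i ∈ Finset.range (ℓ / u), z ^ q ^ (u * i))
    (b c : F) (hb : Tu b = 0 ∨ (Tu b) ^ q ≠ Tu b) :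
    Nat.card {xy : F × F // xy.2 ^ q - xy.2 = xy.1 ^ (q ^ r + 1) + b * xy.1 + c}
      = q ^ ℓ := by
  subst hq
  have : CharP F 2 := charP_of_card_eq_prime_pow (f := n * ℓ) (by rw [hF, pow_mul])
  have hum : u * (ℓ / u) = ℓ := Nat.mul_div_cancel' (hu ▸ Nat.gcd_dvd_left ℓ r)
  have hfix : ∀ z : F, Tu z ^ (2 ^ n) ^ u = Tu z := fun z => by
    rw [hTu]
    exact sum_pow_pow_eq_self (by rw [hum, ← hF, FiniteField.pow_card])
  rw [← hF]
  refine card_artinSchreier_eq_of_translate (fun x => x ^ ((2 ^ n) ^ r + 1) + b * x)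
    (fun d => ?_) c
  obtain ⟨w, hw, hwd⟩ :=
    exists_sq_add_mul_sub_mem_range_artinSchreierHom (hfix b) (hfix d) hb
  have hpow : ∀ k, w ^ (2 ^ n) ^ (u * k) = w := by
    intro k
    induction k with
    | zero => simp
    | succ k ih => rw [mul_add, mul_one, pow_add, pow_mul, ih, hw]
  have hwr : w ^ (2 ^ n) ^ r = w := by
    obtain ⟨k, hk⟩ : u ∣ r := hu ▸ Nat.gcd_dvd_right ℓ r
    rw [hk, hpow]
  have hbw : Tu (b * w) = Tu b * w := by
    rw [hTu, hTu, Finset.sum_mul]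
    exact Finset.sum_congr rfl fun i _ => by rw [mul_pow, hpow]
  have h₁ := sum_pow_sub_mem_range_artinSchreierHom (n := n) u hodd (b * w)
  have h₂ := sum_pow_sub_mem_range_artinSchreierHom (n := n) u hodd d
  rw [← hTu] at h₁ h₂
  rw [hbw] at h₁
  refine ⟨w, fun x => ?_⟩
  have h₃ := pow_pow_sub_mem_range_artinSchreierHom (p := 2) (n := n) (x * w) r
  rw [mul_pow, hwr] at h₃
  convert add_mem (add_mem h₃ hwd) (sub_mem h₂ h₁) using 1
  have hx : (x + w) ^ (2 ^ n) ^ r = x ^ (2 ^ n) ^ r + w := by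
    rw [← pow_mul 2 n r, add_pow_char_pow, pow_mul 2 n r, hwr]
  simp only [pow_succ _ ((2 ^ n) ^ r), hx]
  linear_combination (x * w) * CharTwo.two_eq_zero (R := F)
end

section
/- Let q = 2^n, and let ℓ ≥ 2 and r ≥ 0 be integers such that ℓ/u is odd, where u = gcd(ℓ, r) (with u = ℓ when r = 0). Let b, c ∈ F_{q^ℓ} and suppose T_u(b) is a nonzero element of F_q. Then there exists ω ∈ F_{q^ℓ} with b·T_u(b)^{−1} = ω^{q^{2r}} + ω + 1, and for any such ω one has, as an equality in ℂ, N_{ℓ,r}(1, b, c) = q^ℓ + χ₁(ω^{q^r+1} + ω) · ((2/(ℓ/u)))^{n·u} · q^{(ℓ+u)/2} · χ₁(T_u(b)^{−2}·c), where all χ₁-values here are ±1 since p = 2. -/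
open scoped Classical

open Finset

/-- The sum `z + z ^ 2 + z ^ 4 + ⋯` of the first `N` iterated squares of `z`; it is the absolute
trace when `z` lies in the field with `2 ^ N` elements. -/
def frobSum {F : Type*} [Field F] (N : ℕ) (z : F) : F := ∑ i ∈ range N, z ^ 2 ^ i

/-- The canonical additive character of the field with `2 ^ N` elements. -/
noncomputable def traceSign {F : Type*} [Field F] (N : ℕ) (z : F) : ℤ :=
  if frobSum N z = 0 then 1 else -1

section Character

variable {F : Type*} [Field F]

lemma charTwo_of_card [Fintype F] {N : ℕ} (hF : Fintype.card F = 2 ^ N) : CharP F 2 := by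
  refine CharTwo.of_one_ne_zero_of_two_eq_zero one_ne_zero ?_
  have h : ((Fintype.card F : ℕ) : F) = 0 := FiniteField.cast_card_eq_zero F
  rw [hF] at h
  push_cast at h
  exact eq_zero_of_pow_eq_zero h

lemma pow_two_pow_eq_self [Fintype F] {N : ℕ} (hF : Fintype.card F = 2 ^ N) (x : F) :
    x ^ 2 ^ N = x := by
  rw [← hF, FiniteField.pow_card]

lemma pow_two_pow_mul {x : F} {k : ℕ} (h : x ^ 2 ^ k = x) (m : ℕ) : x ^ 2 ^ (k * m) = x := by
  induction m with
  | zero => simp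
  | succ m ih => rw [Nat.mul_succ, pow_add, pow_mul, ih, h]

lemma frobSum_add [CharP F 2] (N : ℕ) (x y : F) :
    frobSum N (x + y) = frobSum N x + frobSum N y := by
  simp only [frobSum, add_pow_char_pow, sum_add_distrib]

lemma frobSum_pow [CharP F 2] (N k : ℕ) (x : F) :
    frobSum N (x ^ 2 ^ k) = frobSum N x ^ 2 ^ k := by
  simp only [frobSum, sum_pow_char_pow, ← pow_mul, mul_comm]

lemma frobSum_sq_arg [CharP F 2] {N : ℕ} {x : F} (hx : x ^ 2 ^ N = x) :
    frobSum N (x ^ 2) = frobSum N x := by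
  have h1 := sum_range_succ (fun i => x ^ 2 ^ i) N
  have h2 := sum_range_succ' (fun i => x ^ 2 ^ i) N
  simp only [hx, pow_zero, pow_one] at h1 h2
  rw [h1] at h2
  simp only [frobSum, ← pow_mul, ← pow_succ']
  exact (add_right_cancel h2).symm

lemma frobSum_eq_zero_or_one [CharP F 2] {N : ℕ} {x : F} (hx : x ^ 2 ^ N = x) :
    frobSum N x = 0 ∨ frobSum N x = 1 := by
  have h := frobSum_pow N 1 x
  rw [pow_one, frobSum_sq_arg hx] at h
  have h' : frobSum N x * (frobSum N x - 1) = 0 := by linear_combination -h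
  rcases mul_eq_zero.1 h' with h | h
  · exact Or.inl h
  · exact Or.inr (sub_eq_zero.1 h)

lemma frobSum_mul_of_pow_eq [CharP F 2] {x : F} {a k : ℕ} (hx : x ^ 2 ^ a = x) (hk : Odd k) :
    frobSum (a * k) x = frobSum a x := by
  have key : ∀ k : ℕ, frobSum (a * k) x = k * frobSum a x := by
    intro k
    induction k with
    | zero => simp [frobSum]
    | succ k ih =>
      have : frobSum (a * (k + 1)) x = frobSum (a * k) x + frobSum a x := by
        simp only [frobSum, Nat.mul_succ, sum_range_add, pow_add, pow_mul x (2 ^ (a * k)),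
          pow_two_pow_mul hx]
      rw [this, ih]
      push_cast
      ring
  rw [key, CharTwo.natCast_eq_ite, if_neg (Nat.not_even_iff_odd.2 hk), one_mul]

lemma traceSign_eq_or (N : ℕ) (z : F) : traceSign N z = 1 ∨ traceSign N z = -1 := by
  unfold traceSign
  split_ifs <;> simp

lemma traceSign_zero (N : ℕ) : traceSign N (0 : F) = 1 := by
  simp [traceSign, frobSum]

lemma traceSign_mul_self (N : ℕ) (z : F) : traceSign N z * traceSign N z = 1 := by
  rcases traceSign_eq_or N z with h | h <;> simp [h]

lemma traceSign_pow [CharP F 2] (N k : ℕ) (x : F) :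
    traceSign N (x ^ 2 ^ k) = traceSign N x := by
  unfold traceSign
  rw [frobSum_pow]
  simp

variable [Fintype F] [CharP F 2] {N : ℕ}

lemma traceSign_add (hF : Fintype.card F = 2 ^ N) (x y : F) :
    traceSign N (x + y) = traceSign N x * traceSign N y := by
  unfold traceSign
  rw [frobSum_add]
  rcases frobSum_eq_zero_or_one (pow_two_pow_eq_self hF x) with h | h <;>
  rcases frobSum_eq_zero_or_one (pow_two_pow_eq_self hF y) with h' | h' <;>
  simp [h, h', CharTwo.add_self_eq_zero]

lemma traceSign_pow_add_self (hF : Fintype.card F = 2 ^ N) (k : ℕ) (x : F) :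
    traceSign N (x ^ 2 ^ k + x) = 1 := by
  rw [traceSign_add hF, traceSign_pow, traceSign_mul_self]

omit [CharP F 2] in
lemma exists_traceSign_ne_one (hF : Fintype.card F = 2 ^ N) : ∃ z : F, traceSign N z ≠ 1 := by
  by_contra! h
  have hz : ∀ z : F, frobSum N z = 0 := by
    intro z
    have := h z
    unfold traceSign at this
    by_contra hne
    rw [if_neg hne] at this
    norm_num at this
  obtain _ | M := N
  · have := Fintype.one_lt_card (α := F)
    omega
  let P : Polynomial F := ∑ i ∈ range (M + 1), Polynomial.X ^ 2 ^ i
  have hcoeff : P.coeff (2 ^ 0) = 1 := by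
    rw [Polynomial.finsetSum_coeff, sum_eq_single 0]
    · simp
    · intro i _ hi
      rw [Polynomial.coeff_X_pow, if_neg]
      exact fun h => hi (Nat.pow_right_injective le_rfl h).symm
    · simp
  have hP : P ≠ 0 := by
    intro h0
    rw [h0] at hcoeff
    simp at hcoeff
  have hdeg : P.natDegree ≤ 2 ^ M := by
    refine Polynomial.natDegree_sum_le_of_forall_le _ _ fun i hi => ?_
    rw [Polynomial.natDegree_X_pow]
    exact Nat.pow_le_pow_right (by norm_num) (by simpa [Nat.lt_succ_iff] using hi)
  have hcard : Fintype.card F ≤ P.natDegree := by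
    refine le_trans ?_ (Polynomial.card_roots' P)
    rw [← card_univ]
    refine le_trans (card_le_card ?_) (Multiset.toFinset_card_le _)
    intro z _
    have := hz z
    simp only [Multiset.mem_toFinset, Polynomial.mem_roots hP, Polynomial.IsRoot.def]
    simpa [P, Polynomial.eval_finsetSum, frobSum] using this
  rw [hF, pow_succ] at hcard
  have := Nat.two_pow_pos M
  omega

lemma sum_traceSign_mul (hF : Fintype.card F = 2 ^ N) (a : F) :
    ∑ x : F, traceSign N (x * a) = if a = 0 then (2 : ℤ) ^ N else 0 := by
  split_ifs with ha
  · simp [ha, traceSign_zero, hF]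
  · obtain ⟨z, hz⟩ := exists_traceSign_ne_one hF
    have h1 : ∑ x : F, traceSign N (x * a) = ∑ x : F, traceSign N x :=
      Fintype.sum_equiv (Equiv.mulRight₀ a ha) _ _ fun x => rfl
    have h2 : ∑ x : F, traceSign N (z + x) = ∑ x : F, traceSign N x :=
      Fintype.sum_equiv (Equiv.addLeft z) _ _ fun x => rfl
    simp only [traceSign_add hF, ← mul_sum] at h2
    have h3 : (traceSign N z - 1) * ∑ x : F, traceSign N x = 0 := by linear_combination h2
    rw [h1]
    exact (mul_eq_zero.1 h3).resolve_left (sub_ne_zero.2 hz)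

lemma sum_comp_pow_two_pow (k : ℕ) (g : F → ℤ) : ∑ x : F, g (x ^ 2 ^ k) = ∑ x : F, g x :=
  Fintype.sum_equiv (iterateFrobeniusEquiv F 2 k).toEquiv _ _ fun _ => rfl

lemma card_pow_add_eq (hF : Fintype.card F = 2 ^ N) (k : ℕ) (z : F) :
    (#{y : F | y ^ 2 ^ k + y = z} : ℤ) = ∑ w : F with w ^ 2 ^ k = w, traceSign N (w * z) := by
  have h0 : (2 : ℤ) ^ N ≠ 0 := by positivity
  apply mul_left_cancel₀ h0
  have hl : (2 : ℤ) ^ N * (#{y : F | y ^ 2 ^ k + y = z} : ℤ)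
      = ∑ y : F, ∑ w : F, traceSign N (w * (y ^ 2 ^ k + y + z)) := by
    simp only [sum_traceSign_mul hF, CharTwo.add_eq_zero]
    rw [← sum_filter, sum_const, nsmul_eq_mul, mul_comm]
  rw [hl, sum_comm, mul_sum, sum_filter]
  refine sum_congr rfl fun w _ => ?_
  have : ∀ y : F, traceSign N (w * (y ^ 2 ^ k + y + z))
      = traceSign N (y ^ 2 ^ k * (w ^ 2 ^ k + w)) * traceSign N (w * z) := by
    intro y
    rw [mul_add, mul_add, traceSign_add hF, traceSign_add hF, mul_add, traceSign_add hF,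
      ← mul_pow, traceSign_pow, mul_comm w y, mul_comm w]
    ring
  simp only [this, ← sum_mul, sum_comp_pow_two_pow k fun y => traceSign N (y * (w ^ 2 ^ k + w)),
    sum_traceSign_mul hF, CharTwo.add_eq_zero, ite_mul, zero_mul]

omit [CharP F 2] in
lemma card_pow_two_pow_eq {a b : ℕ} (hF : Fintype.card F = 2 ^ (a * b)) :
    #{y : F | y ^ 2 ^ a = y} = 2 ^ a := by
  have hdvd : 2 ^ a - 1 ∣ 2 ^ (a * b) - 1 := by
    rw [pow_mul]
    simpa using Nat.sub_dvd_pow_sub_pow (2 ^ a) 1 b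
  have hker := IsCyclic.card_powMonoidHom_ker (G := Fˣ) (2 ^ a - 1)
  rw [Nat.card_eq_fintype_card (α := Fˣ), Fintype.card_units, hF, Nat.gcd_eq_right hdvd] at hker
  have hpos := Nat.two_pow_pos a
  have himg : ({y : F | y ^ 2 ^ a = y} : Finset F)
      = insert 0 ((univ.filter fun v : Fˣ => v ^ (2 ^ a - 1) = 1).image Units.val) := by
    ext y
    simp only [mem_filter, mem_univ, true_and, mem_insert, mem_image]
    constructor
    · intro h
      by_cases hy : y = 0
      · exact Or.inl hy
      · refine Or.inr ⟨Units.mk0 y hy, ?_, rfl⟩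
        ext
        apply mul_right_cancel₀ hy
        simp only [Units.val_pow_eq_pow_val, Units.val_mk0, Units.val_one, one_mul]
        rw [← pow_succ, Nat.sub_add_cancel hpos, h]
    · rintro (rfl | ⟨v, hv, rfl⟩)
      · simp
      · rw [← Nat.sub_add_cancel hpos, pow_succ, ← Units.val_pow_eq_pow_val, hv]
        simp
  rw [himg, card_insert_of_notMem (by simp), card_image_of_injective _ Units.val_injective]
  have : Nat.card (powMonoidHom (2 ^ a - 1) : Fˣ →* Fˣ).ker
      = #(univ.filter fun v : Fˣ => v ^ (2 ^ a - 1) = 1) := by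
    rw [Nat.card_eq_fintype_card, ← Fintype.card_subtype]
    exact Fintype.card_congr (Equiv.subtypeEquivRight fun v => by simp [MonoidHom.mem_ker])
  omega

end Character

section GoldSum

lemma sum_zmod_eq_sum_fixed {α : Type*} [Fintype α] {p : ℕ} [Fact p.Prime] (f : α → α)
    (hf : ∀ x, f^[p] x = x) (g : α → ℤ) (hg : ∀ x, g (f x) = g x) :
    ((∑ x, g x : ℤ) : ZMod p) = ((∑ x with f x = x, g x : ℤ) : ZMod p) := by
  have hcard : ∀ v : ℤ, (#{x | g x = v} : ZMod p) = (#{x | f x = x ∧ g x = v} : ZMod p) := by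
    intro v
    let fv : Function.End {x // g x = v} := fun x => ⟨f x, by rw [hg]; exact x.2⟩
    have hval : ∀ (k : ℕ) (x : {x // g x = v}), ((fv ^ k) x : α) = f^[k] x := by
      intro k
      induction k with
      | zero => intro x; rfl
      | succ k ih =>
        intro x
        rw [pow_succ', Function.iterate_succ_apply', ← ih]
        rfl
    have hfv : fv ^ p ^ 1 = 1 := by
      funext x
      apply Subtype.ext
      rw [pow_one, hval, hf]
      rfl
    have h := Equiv.Perm.card_fixedPoints_modEq hfv
    rw [← ZMod.natCast_eq_natCast_iff] at h
    rw [← Fintype.card_subtype, h, ← Fintype.card_subtype]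
    congr 1
    refine Fintype.card_congr
      { toFun := fun x => ⟨x.1.1, congrArg Subtype.val x.2, x.1.2⟩
        invFun := fun x => ⟨⟨x.1, x.2.2⟩, Subtype.ext x.2.1⟩
        left_inv := fun x => rfl
        right_inv := fun x => rfl }
  have hsum : ∀ s : Finset α, ((∑ x ∈ s, g x : ℤ) : ZMod p)
      = ∑ v ∈ univ.image g, (#{x ∈ s | g x = v} : ZMod p) * (v : ZMod p) := by
    intro s
    rw [← sum_fiberwise_of_maps_to (t := univ.image g)
      (fun x _ => mem_image_of_mem g (mem_univ x))]
    push_cast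
    refine sum_congr rfl fun v _ => ?_
    rw [sum_congr rfl (g := fun _ => (v : ZMod p))
      (fun x hx => by rw [(mem_filter.1 hx).2]), sum_const, nsmul_eq_mul]
  rw [hsum, hsum]
  refine sum_congr rfl fun v _ => ?_
  rw [hcard, filter_filter]

variable {F : Type*} [Field F]

/-- The exponential sum attached to the Gold function `x ↦ x ^ (2 ^ k + 1)`. -/
noncomputable def goldSum (F : Type*) [Field F] [Fintype F] (N k : ℕ) : ℤ :=
  ∑ x : F, traceSign N (x ^ (2 ^ k + 1) + x)

lemma add_pow_two_pow_add_one [CharP F 2] (k : ℕ) (x y : F) :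
    (x + y) ^ (2 ^ k + 1)
      = x ^ (2 ^ k + 1) + (x ^ 2 ^ k * y + x * y ^ 2 ^ k) + y ^ (2 ^ k + 1) := by
  rw [pow_succ, add_pow_char_pow]
  ring

variable [Fintype F]

lemma pow_eq_self_of_coprime {e L m : ℕ} (hF : Fintype.card F = 2 ^ (e * L))
    (hm : m.Coprime L) {y : F} (hy : y ^ 2 ^ (e * m) = y) : y ^ 2 ^ e = y := by
  have h1 : Function.IsPeriodicPt (fun x : F => x ^ 2 ^ e) m y := by
    rw [Function.IsPeriodicPt, Function.IsFixedPt, pow_iterate, ← pow_mul]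
    exact hy
  have h2 : Function.IsPeriodicPt (fun x : F => x ^ 2 ^ e) L y := by
    rw [Function.IsPeriodicPt, Function.IsFixedPt, pow_iterate, ← pow_mul]
    exact pow_two_pow_eq_self hF y
  have h := h1.gcd h2
  rw [hm] at h
  exact h

lemma traceSign_sq_add_self_of_fixed [CharP F 2] {N e s : ℕ} (hF : Fintype.card F = 2 ^ N)
    {y : F} (hy : y ^ 2 ^ e = y) : traceSign N (y ^ (2 ^ (e * s) + 1) + y) = 1 := by
  rw [pow_succ, pow_two_pow_mul hy, ← sq]
  simpa using traceSign_pow_add_self hF 1 y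

lemma goldSum_sq {e s L : ℕ} (hF : Fintype.card F = 2 ^ (e * L)) (hL : Odd L)
    (hs : s.Coprime L) : goldSum F (e * L) (e * s) ^ 2 = 2 ^ (e * (L + 1)) := by
  have := charTwo_of_card hF
  obtain ⟨k, hk⟩ : ∃ k, k = e * s := ⟨_, rfl⟩
  rw [← hk]
  have hpair : ∀ x y : F, traceSign (e * L) (x ^ (2 ^ k + 1) + x)
      * traceSign (e * L) ((x + y) ^ (2 ^ k + 1) + (x + y))
      = traceSign (e * L) (y ^ (2 ^ k + 1) + y)
        * traceSign (e * L) (x ^ 2 ^ k * (y ^ 2 ^ (2 * k) + y)) := by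
    intro x y
    have h1 : traceSign (e * L) (x ^ 2 ^ k * y ^ 2 ^ (2 * k))
        = traceSign (e * L) (x * y ^ 2 ^ k) := by
      rw [two_mul, pow_add 2 k k, pow_mul, ← mul_pow, traceSign_pow]
    rw [mul_add, traceSign_add hF (x ^ 2 ^ k * _), h1, ← traceSign_add hF, ← traceSign_add hF,
      ← traceSign_add hF, add_pow_two_pow_add_one]
    congr 1
    linear_combination (x ^ (2 ^ k + 1) + x) * CharTwo.two_eq_zero (R := F)
  have hfix : ∀ y : F, y ^ 2 ^ (2 * k) = y ↔ y ^ 2 ^ e = y := by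
    intro y
    rw [show 2 * k = e * (2 * s) by rw [hk]; ring]
    refine ⟨pow_eq_self_of_coprime hF ?_, fun h => pow_two_pow_mul h _⟩
    exact Nat.Coprime.mul_left (Nat.coprime_two_left.2 hL) hs
  calc goldSum F (e * L) k ^ 2
      = ∑ x : F, ∑ y : F, traceSign (e * L) (x ^ (2 ^ k + 1) + x)
          * traceSign (e * L) ((x + y) ^ (2 ^ k + 1) + (x + y)) := by
        rw [sq, goldSum, sum_mul_sum]
        refine sum_congr rfl fun x _ => ?_
        exact (Fintype.sum_equiv (Equiv.addLeft x) _ _ fun y => rfl).symm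
    _ = ∑ y : F, traceSign (e * L) (y ^ (2 ^ k + 1) + y)
          * ∑ x : F, traceSign (e * L) (x ^ 2 ^ k * (y ^ 2 ^ (2 * k) + y)) := by
        rw [sum_comm]
        simp only [hpair, mul_sum]
    _ = ∑ y : F with y ^ 2 ^ e = y, (2 : ℤ) ^ (e * L) := by
        rw [sum_filter]
        refine sum_congr rfl fun y _ => ?_
        rw [sum_comp_pow_two_pow k fun x => traceSign (e * L) (x * (y ^ 2 ^ (2 * k) + y)),
          sum_traceSign_mul hF]
        simp only [CharTwo.add_eq_zero, hfix]
        split_ifs with h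
        · rw [hk, traceSign_sq_add_self_of_fixed hF h, one_mul]
        · simp
    _ = 2 ^ (e * (L + 1)) := by
        rw [sum_const, card_pow_two_pow_eq hF, nsmul_eq_mul]
        push_cast
        rw [← pow_add]
        congr 1
        ring

omit [Fintype F] in
lemma coe_frobSum {E : Subfield F} (N : ℕ) (z : E) :
    ((frobSum N z : E) : F) = frobSum N (z : F) := by
  simp [frobSum]

omit [Fintype F] in
lemma traceSign_congr {K : Type*} [Field K] {M N : ℕ} {z : F} {w : K}
    (h : frobSum M z = 0 ↔ frobSum N w = 0) : traceSign M z = traceSign N w := by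
  unfold traceSign
  by_cases hz : frobSum M z = 0
  · rw [if_pos hz, if_pos (h.1 hz)]
  · rw [if_neg hz, if_neg (mt h.2 hz)]

lemma goldSum_zmod_eq {e m s p : ℕ} [Fact p.Prime] (hp : Odd p)
    (hF : Fintype.card F = 2 ^ (e * (p * m))) :
    ∃ E : Subfield F, Fintype.card E = 2 ^ (e * m) ∧
      (goldSum F (e * (p * m)) (e * s) : ZMod p) = (goldSum E (e * m) (e * s) : ZMod p) := by
  have := charTwo_of_card hF
  have hN : e * (p * m) = e * m * p := by ring
  let E : Subfield F := (iterateFrobenius F 2 (e * m)).eqLocusField (RingHom.id F)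
  have hE : ∀ x : F, x ∈ E ↔ x ^ 2 ^ (e * m) = x := fun x => Iff.rfl
  refine ⟨E, ?_, ?_⟩
  · rw [← card_pow_two_pow_eq (F := F) (a := e * m) (b := p) (by rw [hF, hN]),
      ← Fintype.card_subtype]
    exact Fintype.card_congr (Equiv.subtypeEquivRight hE)
  · have h := sum_zmod_eq_sum_fixed (p := p) (fun x : F => x ^ 2 ^ (e * m))
      (fun x => by rw [pow_iterate, ← pow_mul, ← hN]; exact pow_two_pow_eq_self hF x)
      (fun x => traceSign (e * (p * m)) (x ^ (2 ^ (e * s) + 1) + x))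
      (fun x => by
        rw [← traceSign_pow _ (e * m) (x ^ (2 ^ (e * s) + 1) + x), add_pow_char_pow,
          pow_right_comm])
    rw [goldSum, goldSum, h]
    congr 1
    rw [sum_subtype (p := fun x => x ∈ E) _ (fun x => by simp [hE])]
    refine sum_congr rfl fun x _ => ?_
    have hx : ((x : F) ^ (2 ^ (e * s) + 1) + x) ∈ E :=
      E.add_mem (E.pow_mem x.2 _) x.2
    apply traceSign_congr
    rw [hN, frobSum_mul_of_pow_eq ((hE _).1 hx) hp, ← ZeroMemClass.coe_eq_zero, coe_frobSum]
    rfl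

lemma ZMod.intCast_inj_of_sq_eq_one {p : ℕ} [Fact p.Prime] (hp : p ≠ 2) {x y : ℤ}
    (hx : x = 1 ∨ x = -1) (hy : y = 1 ∨ y = -1) (h : (x : ZMod p) = (y : ZMod p)) : x = y := by
  have : Fact (2 < p) := ⟨lt_of_le_of_ne (Fact.out : p.Prime).two_le hp.symm⟩
  rcases hx with rfl | rfl <;> rcases hy with rfl | rfl <;>
    simp_all [ZMod.neg_one_ne_one, ZMod.neg_one_ne_one.symm]

theorem goldSum_eq (e s : ℕ) : ∀ L : ℕ, Odd L → s.Coprime L →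
    ∀ (F : Type*) [Field F] [Fintype F], Fintype.card F = 2 ^ (e * L) →
      goldSum F (e * L) (e * s) = jacobiSym 2 L ^ e * 2 ^ (e * ((L + 1) / 2)) := by
  intro L
  induction L using induction_on_primes with
  | zero => intro h; simp at h
  | one =>
    intro _ _ F _ _ hF
    have := charTwo_of_card hF
    rw [goldSum, sum_congr rfl fun x _ => traceSign_sq_add_self_of_fixed hF (e := e) (s := s)
      (by simpa using pow_two_pow_eq_self hF x)]
    simp [hF]
  | prime_mul p m hp ih =>
    intro hodd hs F _ _ hF
    have hpo : Odd p := Nat.Odd.of_mul_left hodd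
    have hmo : Odd m := Nat.Odd.of_mul_right hodd
    have : Fact p.Prime := ⟨hp⟩
    have hp2 : p ≠ 2 := by rintro rfl; exact absurd hpo (by decide)
    have hsm : s.Coprime m := hs.coprime_mul_left_right
    obtain ⟨E, hEcard, hE⟩ := goldSum_zmod_eq (s := s) hpo hF
    rw [ih hmo hsm E hEcard] at hE
    have hsq := goldSum_sq hF hodd hs
    obtain ⟨a, rfl⟩ := hpo
    obtain ⟨c, rfl⟩ := hmo
    set p := 2 * a + 1 with hpdef
    set m := 2 * c + 1 with hmdef
    have hm2 : (m + 1) / 2 = c + 1 := by omega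
    have hL2 : (p * m + 1) / 2 = c + 1 + m * a := by
      have : p * m + 1 = 2 * (c + 1 + m * a) := by rw [hpdef, hmdef]; ring
      omega
    rw [hm2] at hE
    rw [hL2]
    have h2 : (2 : ZMod p) ≠ 0 := by
      have : Fact (2 < p) := ⟨lt_of_le_of_ne hp.two_le hp2.symm⟩
      exact Ring.two_ne_zero (by rwa [ZMod.ringChar_zmod_n])
    have hgcdp : (2 : ℤ).gcd p = 1 := Nat.coprime_two_left.2 ⟨a, rfl⟩
    have hgcdm : (2 : ℤ).gcd m = 1 := Nat.coprime_two_left.2 ⟨c, rfl⟩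
    have hleg : (jacobiSym 2 p : ZMod p) = 2 ^ a := by
      rw [← jacobiSym.legendreSym.to_jacobiSym, legendreSym.eq_pow, show p / 2 = a by omega]
      norm_num
    have hJp := jacobiSym.eq_one_or_neg_one hgcdp
    have hJm := jacobiSym.eq_one_or_neg_one hgcdm
    have hJpm : jacobiSym 2 p ^ m = jacobiSym 2 p := by
      rcases hJp with h | h <;> rw [h]
      · simp
      · exact Odd.neg_one_pow ⟨c, rfl⟩
    obtain ⟨ε, hε, hG⟩ : ∃ ε : ℤ, (ε = 1 ∨ ε = -1) ∧
        goldSum F (e * (p * m)) (e * s) = ε * 2 ^ (e * (c + 1 + m * a)) := by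
      have : goldSum F (e * (p * m)) (e * s) ^ 2 = (2 ^ (e * (c + 1 + m * a))) ^ 2 := by
        rw [hsq, ← pow_mul]
        congr 1
        rw [hpdef, hmdef]
        ring
      rcases sq_eq_sq_iff_eq_or_eq_neg.1 this with h | h
      · exact ⟨1, Or.inl rfl, by rw [h, one_mul]⟩
      · exact ⟨-1, Or.inr rfl, by rw [h, neg_one_mul]⟩
    rw [hG] at hE ⊢
    have hpowp : (2 : ZMod p) ^ (e * (c + 1 + m * a))
        = (jacobiSym 2 p : ZMod p) ^ e * 2 ^ (e * (c + 1)) := by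
      have : (2 : ZMod p) ^ (e * (c + 1 + m * a)) = (((2 ^ a) ^ m) ^ e) * 2 ^ (e * (c + 1)) := by
        rw [← pow_mul, ← pow_mul, ← pow_add]
        congr 1
        ring
      rw [this, ← hleg, ← Int.cast_pow, hJpm]
    push_cast at hE
    rw [hpowp, ← mul_assoc] at hE
    have hE' := mul_right_cancel₀ (pow_ne_zero _ h2) hE
    have hpm : ∀ {x : ℤ}, (x = 1 ∨ x = -1) → x ^ e = 1 ∨ x ^ e = -1 := by
      rintro x (rfl | rfl)
      · simp
      · exact neg_one_pow_eq_or ℤ e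
    have hfin : ε * jacobiSym 2 p ^ e = jacobiSym 2 m ^ e := by
      refine ZMod.intCast_inj_of_sq_eq_one hp2 ?_ (hpm hJm) (by exact_mod_cast hE')
      rcases hε with rfl | rfl <;> rcases hpm hJp with h | h <;> simp [h]
    rw [jacobiSym.mul_right, mul_pow, ← hfin]
    rcases hpm hJp with h | h <;> rw [h] <;> ring

end GoldSum

section Count

variable {F : Type*} [Field F]

/-- The trace map onto the field with `2 ^ e` elements, on the field with `2 ^ (e * L)` elements. -/
def relTrace (e L : ℕ) (z : F) : F := ∑ i ∈ range L, z ^ 2 ^ (e * i)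

lemma relTrace_mul {e : ℕ} {w : F} (hw : w ^ 2 ^ e = w) (L : ℕ) (z : F) :
    relTrace e L (w * z) = w * relTrace e L z := by
  simp only [relTrace, mul_pow, pow_two_pow_mul hw, mul_sum]

lemma relTrace_add [CharP F 2] (e L : ℕ) (x y : F) :
    relTrace e L (x + y) = relTrace e L x + relTrace e L y := by
  simp only [relTrace, add_pow_char_pow, sum_add_distrib]

lemma relTrace_one [CharP F 2] (e : ℕ) {L : ℕ} (hL : Odd L) : relTrace e L (1 : F) = 1 := by
  simp [relTrace, CharTwo.natCast_eq_ite, Nat.not_even_iff_odd.2 hL]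

lemma relTrace_pow_two_pow {e L : ℕ} {z : F} (hz : z ^ 2 ^ (e * L) = z) (m : ℕ) :
    relTrace e L (z ^ 2 ^ (e * m)) = relTrace e L z := by
  induction m with
  | zero => simp
  | succ m ih =>
    rw [← ih]
    have hy : (z ^ 2 ^ (e * m)) ^ 2 ^ (e * L) = z ^ 2 ^ (e * m) := by rw [pow_right_comm, hz]
    rw [Nat.mul_succ, pow_add 2, pow_mul]
    generalize z ^ 2 ^ (e * m) = y at hy
    have h1 := sum_range_succ (fun i => y ^ 2 ^ (e * i)) L
    have h2 := sum_range_succ' (fun i => y ^ 2 ^ (e * i)) L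
    simp only [hy, mul_zero, pow_zero, pow_one] at h1 h2
    rw [h1] at h2
    simp only [relTrace, ← pow_mul, ← pow_add, add_comm e, ← Nat.mul_succ]
    exact (add_right_cancel h2).symm

lemma frobSum_relTrace [CharP F 2] (e L : ℕ) (z : F) :
    frobSum e (relTrace e L z) = frobSum (e * L) z := by
  induction L with
  | zero => simp [frobSum, relTrace]
  | succ L ih =>
    have h1 : relTrace e (L + 1) z = relTrace e L z + z ^ 2 ^ (e * L) := sum_range_succ _ _
    have h2 : frobSum (e * (L + 1)) z = frobSum (e * L) z + frobSum e (z ^ 2 ^ (e * L)) := by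
      simp only [frobSum, Nat.mul_succ, sum_range_add, pow_add, pow_mul z (2 ^ (e * L))]
    rw [h1, h2, frobSum_add, ih]

variable [Fintype F]

lemma exists_pow_add_of_forall_traceSign [CharP F 2] {N k : ℕ} (hF : Fintype.card F = 2 ^ N) {z : F}
    (h : ∀ w : F, w ^ 2 ^ k = w → traceSign N (w * z) = 1) : ∃ ω : F, ω ^ 2 ^ k + ω = z := by
  have hc := card_pow_add_eq hF k z
  rw [sum_congr rfl fun w hw => h w (mem_filter.1 hw).2, sum_const, nsmul_one] at hc
  have hpos : 0 < #{w : F | w ^ 2 ^ k = w} := card_pos.2 ⟨1, by simp⟩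
  obtain ⟨ω, hω⟩ := card_pos.1 (show 0 < #{y : F | y ^ 2 ^ k + y = z} by omega)
  exact ⟨ω, (mem_filter.1 hω).2⟩

lemma exists_pow_add_of_relTrace_eq_zero [CharP F 2] {e m L : ℕ}
    (hF : Fintype.card F = 2 ^ (e * L)) (hm : m.Coprime L) {z : F} (hz : relTrace e L z = 0) :
    ∃ ω : F, ω ^ 2 ^ (e * m) + ω = z := by
  refine exists_pow_add_of_forall_traceSign hF fun w hw => ?_
  rw [traceSign, ← frobSum_relTrace, relTrace_mul (pow_eq_self_of_coprime hF hm hw), hz]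
  simp [frobSum]

/-- The exponential sum of the Gold function twisted by the linear form `x ↦ B * x`. -/
noncomputable def goldSumTwist (N k : ℕ) (B : F) : ℤ :=
  ∑ x : F, traceSign N (x ^ (2 ^ k + 1) + B * x)

lemma goldSumTwist_eq [CharP F 2] {N : ℕ} (hF : Fintype.card F = 2 ^ N) (k : ℕ) {B ω : F}
    (hB : B = ω ^ 2 ^ (2 * k) + ω + 1) :
    goldSumTwist N k B = traceSign N (ω ^ (2 ^ k + 1) + ω) * goldSum F N k := by
  have h1 : goldSum F N k = ∑ x : F,
      traceSign N ((x + ω ^ 2 ^ k) ^ (2 ^ k + 1) + (x + ω ^ 2 ^ k)) :=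
    (Fintype.sum_equiv (Equiv.addRight (ω ^ 2 ^ k)) _ _ fun x => rfl).symm
  rw [h1, goldSumTwist, mul_sum]
  refine sum_congr rfl fun x _ => ?_
  have h2 : traceSign N (x ^ 2 ^ k * ω ^ 2 ^ k) = traceSign N (x * ω) := by
    rw [← mul_pow, traceSign_pow]
  have h3 : traceSign N ((ω ^ 2 ^ k) ^ (2 ^ k + 1)) = traceSign N (ω ^ (2 ^ k + 1)) := by
    rw [pow_right_comm, traceSign_pow]
  have h4 : (ω ^ 2 ^ k) ^ 2 ^ k = ω ^ 2 ^ (2 * k) := by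
    rw [← pow_mul, ← pow_add, two_mul]
  have h5 : x ^ (2 ^ k + 1) + B * x
      = x ^ (2 ^ k + 1) + (x * ω ^ 2 ^ (2 * k) + (x * ω + x)) := by
    rw [hB]
    ring
  rw [add_pow_two_pow_add_one, h5, h4]
  simp only [traceSign_add hF, traceSign_pow, h2, h3]
  linear_combination -(traceSign N (x ^ (2 ^ k + 1)) * traceSign N (x * ω ^ 2 ^ (2 * k))
    * traceSign N (x * ω) * traceSign N x) * (traceSign_mul_self N ω
      + traceSign N ω * traceSign N ω * traceSign_mul_self N (ω ^ (2 ^ k + 1)))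

lemma exists_of_goldSumTwist_ne_zero [CharP F 2] {N : ℕ} (hF : Fintype.card F = 2 ^ N) {k : ℕ}
    (hfix : ∀ w : F, w ^ 2 ^ (2 * k) = w → w ^ 2 ^ k = w) {B : F}
    (hB : goldSumTwist N k B ≠ 0) : ∃ ω : F, B = ω ^ 2 ^ (2 * k) + ω + 1 := by
  obtain ⟨ω, hω⟩ := exists_pow_add_of_forall_traceSign hF (k := 2 * k) (z := B + 1) (by
    intro w hw
    have hwk := hfix w hw
    have hshift : goldSumTwist N k B = traceSign N (w * (B + 1)) * goldSumTwist N k B := by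
      conv_lhs => rw [goldSumTwist, ← Equiv.sum_comp (Equiv.addRight w)]
      rw [goldSumTwist, mul_sum]
      refine sum_congr rfl fun x _ => ?_
      have h1 : traceSign N (x ^ 2 ^ k * w) = traceSign N (x * w) := by
        conv_lhs => rw [← hwk]
        rw [← mul_pow, traceSign_pow]
      have h2 : traceSign N (w ^ (2 ^ k + 1)) = traceSign N w := by
        rw [pow_succ, hwk, ← sq]
        simpa using traceSign_pow N 1 w
      rw [Equiv.coe_addRight, add_pow_two_pow_add_one, hwk, mul_add, mul_add, mul_comm w B]
      simp only [traceSign_add hF, h1, h2, mul_one]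
      linear_combination (traceSign N (x ^ (2 ^ k + 1)) * traceSign N (B * x)
        * traceSign N (B * w) * traceSign N w) * traceSign_mul_self N (x * w)
    exact mul_right_cancel₀ hB (by rw [one_mul, ← hshift]))
  exact ⟨ω, by rw [hω, CharTwo.add_cancel_right]⟩

lemma sum_fixed_comp_sq [CharP F 2] (n : ℕ) (h : F → ℤ) :
    ∑ w : F with w ^ 2 ^ n = w, h w = ∑ w : F with w ^ 2 ^ n = w, h (w ^ 2) := by
  rw [sum_filter, sum_filter,
    ← sum_comp_pow_two_pow 1 fun w : F => if w ^ 2 ^ n = w then h w else 0]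
  refine sum_congr rfl fun w _ => ?_
  simp only [pow_one, pow_right_comm w 2, CharTwo.sq_inj]

lemma card_curve_eq_sum [CharP F 2] {N : ℕ} (hF : Fintype.card F = 2 ^ N) (n : ℕ) (f : F → F) :
    (Nat.card {xy : F × F // xy.2 ^ 2 ^ n - xy.2 = f xy.1} : ℤ)
      = ∑ w : F with w ^ 2 ^ n = w, ∑ x : F, traceSign N (w ^ 2 * f x) := by
  have h : Nat.card {xy : F × F // xy.2 ^ 2 ^ n - xy.2 = f xy.1}
      = ∑ x : F, #{y : F | y ^ 2 ^ n + y = f x} := by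
    rw [Nat.card_eq_fintype_card, Fintype.card_subtype, card_filter, Fintype.sum_prod_type]
    simp only [CharTwo.sub_eq_add, card_filter]
  rw [h]
  push_cast
  simp only [card_pow_add_eq hF]
  rw [sum_comm, sum_fixed_comp_sq n fun w => ∑ x : F, traceSign N (w * f x)]

lemma sum_traceSign_sq_mul [CharP F 2] {N k : ℕ} (hF : Fintype.card F = 2 ^ N) {w : F}
    (hw0 : w ≠ 0) (hw : w ^ 2 ^ k = w) (b c : F) :
    ∑ x : F, traceSign N (w ^ 2 * (x ^ (2 ^ k + 1) + b * x + c))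
      = goldSumTwist N k (w * b) * traceSign N (w ^ 2 * c) := by
  rw [goldSumTwist, sum_mul, ← Equiv.sum_comp (Equiv.mulLeft₀ w hw0) fun x =>
    traceSign N (x ^ (2 ^ k + 1) + w * b * x) * traceSign N (w ^ 2 * c)]
  refine sum_congr rfl fun x _ => ?_
  change _ = traceSign N ((w * x) ^ (2 ^ k + 1) + w * b * (w * x)) * _
  rw [← traceSign_add hF, mul_pow, pow_succ w (2 ^ k), hw]
  congr 1
  ring

theorem card_goldCurve [CharP F 2] {n u s L : ℕ} (hF : Fintype.card F = 2 ^ (n * u * L))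
    (hL : Odd L) (hs : s.Coprime L) {b c ω : F} (hb0 : relTrace (n * u) L b ≠ 0)
    (hbn : relTrace (n * u) L b ^ 2 ^ n = relTrace (n * u) L b)
    (hω : b * (relTrace (n * u) L b)⁻¹ = ω ^ 2 ^ (2 * (n * u * s)) + ω + 1) :
    (Nat.card {xy : F × F // xy.2 ^ 2 ^ n - xy.2
        = xy.1 ^ (2 ^ (n * u * s) + 1) + b * xy.1 + c} : ℤ)
      = 2 ^ (n * u * L) + traceSign (n * u * L) (ω ^ (2 ^ (n * u * s) + 1) + ω)
          * jacobiSym 2 L ^ (n * u) * 2 ^ (n * u * ((L + 1) / 2))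
          * traceSign (n * u * L) ((relTrace (n * u) L b ^ 2)⁻¹ * c) := by
  set t := relTrace (n * u) L b with ht
  have hfix : ∀ w : F, w ^ 2 ^ (2 * (n * u * s)) = w → w ^ 2 ^ (n * u * s) = w := by
    intro w hw
    rw [show 2 * (n * u * s) = n * u * (2 * s) by ring] at hw
    exact pow_two_pow_mul (pow_eq_self_of_coprime hF
      (Nat.Coprime.mul_left (Nat.coprime_two_left.2 hL) hs) hw) s
  have hk : ∀ {w : F}, w ^ 2 ^ n = w → w ^ 2 ^ (n * u * s) = w := fun hw =>
    pow_two_pow_mul (pow_two_pow_mul hw u) s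
  have htinv : t⁻¹ ^ 2 ^ n = t⁻¹ := by rw [inv_pow, hbn]
  rw [card_curve_eq_sum hF n fun x => x ^ (2 ^ (n * u * s) + 1) + b * x + c,
    sum_eq_add_of_mem 0 t⁻¹ (by simp) (by simpa using hbn) (inv_ne_zero hb0).symm]
  · rw [sum_traceSign_sq_mul hF (inv_ne_zero hb0) (hk htinv), mul_comm t⁻¹ b,
      goldSumTwist_eq hF _ hω, goldSum_eq _ _ L hL hs F hF, inv_pow]
    simp only [ne_eq, OfNat.ofNat_ne_zero, not_false_eq_true, zero_pow, zero_mul, traceSign_zero,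
      sum_const, card_univ, hF, nsmul_one]
    push_cast
    ring
  · rintro w hw ⟨hw0, hwt⟩
    have hwn : w ^ 2 ^ n = w := (mem_filter.1 hw).2
    rw [sum_traceSign_sq_mul hF hw0 (hk hwn)]
    by_contra hne
    obtain ⟨η, hη⟩ := exists_of_goldSumTwist_ne_zero hF hfix (left_ne_zero_of_mul hne)
    apply hwt
    have h1 := congrArg (relTrace (n * u) L) hη
    rw [relTrace_mul (pow_two_pow_mul hwn u), ← ht, relTrace_add, relTrace_add, relTrace_one _ hL,
      show 2 * (n * u * s) = n * u * (2 * s) by ring,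
      relTrace_pow_two_pow (pow_two_pow_eq_self hF η), CharTwo.add_self_eq_zero, zero_add] at h1
    exact eq_inv_of_mul_eq_one_left h1

end Count

/-- Let `q = 2 ^ n`, `ℓ ≥ 2`, `r ≥ 0` with `ℓ / u` odd where `u = gcd(ℓ, r)`.
Let `b, c ∈ F_{q^ℓ}` with `T_u(b)` a nonzero element of `F_q`.  Then there is `ω` with
`b · T_u(b)⁻¹ = ω^(q^(2r)) + ω + 1`, and for any such `ω`,
`N_{ℓ,r}(1, b, c) = q^ℓ + χ₁(ω^(q^r+1) + ω) · (2/(ℓ/u))^(n·u) · q^((ℓ+u)/2) · χ₁(T_u(b)⁻² c)`.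
Since `p = 2`, the canonical additive character `χ₁` takes values `±1`: `χ₁(z) = 1` iff the
absolute trace `∑_{i < nℓ} z^(2^i)` vanishes; `(2/v)` is the Jacobi symbol. -/
theorem stmt_4 (n : ℕ) (hn : 1 ≤ n) (q : ℕ) (hq : q = 2 ^ n)
    (ℓ r : ℕ) (hℓ : 2 ≤ ℓ) (u : ℕ) (hu : u = Nat.gcd ℓ r) (hodd : Odd (ℓ / u))
    (F : Type) [Field F] [Fintype F] (hF : Fintype.card F = q ^ ℓ)
    (Tu : F → F) (hTu : ∀ z : F, Tu z = ∑ i ∈ Finset.range (ℓ / u), z ^ q ^ (u * i))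
    (χ : F → ℤ)
    (hχ : ∀ z : F, χ z = if (∑ i ∈ Finset.range (n * ℓ), z ^ 2 ^ i) = 0 then 1 else -1)
    (J : ℤ) (hJ : J = if (ℓ / u) % 8 = 1 ∨ (ℓ / u) % 8 = 7 then 1 else -1)
    (b c : F) (hb0 : Tu b ≠ 0) (hbq : (Tu b) ^ q = Tu b) :
    (∃ ω : F, b * (Tu b)⁻¹ = ω ^ q ^ (2 * r) + ω + 1) ∧
    ∀ ω : F, b * (Tu b)⁻¹ = ω ^ q ^ (2 * r) + ω + 1 →
      (Nat.card {xy : F × F //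
          xy.2 ^ q - xy.2 = xy.1 ^ (q ^ r + 1) + b * xy.1 + c} : ℤ)
        = (q : ℤ) ^ ℓ + χ (ω ^ (q ^ r + 1) + ω) * J ^ (n * u) * (q : ℤ) ^ ((ℓ + u) / 2)
            * χ (((Tu b) ^ 2)⁻¹ * c) := by
  have hupos : 0 < u := hu ▸ Nat.gcd_pos_of_pos_left r (by omega)
  obtain ⟨L, hL⟩ : u ∣ ℓ := hu ▸ Nat.gcd_dvd_left ℓ r
  obtain ⟨s, hs⟩ : u ∣ r := hu ▸ Nat.gcd_dvd_right ℓ r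
  have hcop : s.Coprime L := by
    rw [hL, hs, Nat.gcd_mul_left] at hu
    exact Nat.Coprime.symm (Nat.eq_of_mul_eq_mul_left hupos (by rw [← hu, mul_one]))
  rw [hL, Nat.mul_div_cancel_left L hupos] at hodd hJ hTu
  have hN : n * ℓ = n * u * L := by rw [hL, mul_assoc]
  have hqr : q ^ r = 2 ^ (n * u * s) := by rw [hq, hs, ← pow_mul, mul_assoc]
  have hqr2 : q ^ (2 * r) = 2 ^ (2 * (n * u * s)) := by
    rw [hq, hs, ← pow_mul]
    congr 1
    ring
  rw [hq, ← pow_mul, hN] at hF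
  have := charTwo_of_card hF
  have hT : Tu b = relTrace (n * u) L b := by
    simp only [hTu, relTrace, hq, ← pow_mul, mul_assoc]
  have hχ' : χ = traceSign (n * u * L) := by
    funext z
    rw [hχ, hN]
    rfl
  have hJ' : J = jacobiSym 2 L := by
    rw [hJ, jacobiSym.at_two hodd, ZMod.χ₈_nat_eq_if_mod_eight,
      Nat.odd_iff.1 hodd, if_neg one_ne_zero]
  rw [hT] at hb0 hbq ⊢
  rw [hq] at hbq
  rw [hqr, hqr2, hχ', hJ']
  constructor
  · obtain ⟨ω, hω⟩ := exists_pow_add_of_relTrace_eq_zero (m := 2 * s) hF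
      (Nat.Coprime.mul_left (Nat.coprime_two_left.2 hodd) hcop)
      (z := b * (relTrace (n * u) L b)⁻¹ + 1) (by
        rw [relTrace_add, relTrace_one _ hodd, mul_comm b, relTrace_mul, inv_mul_cancel₀ hb0,
          CharTwo.add_self_eq_zero]
        exact pow_two_pow_mul (by rw [inv_pow, hbq]) u)
    refine ⟨ω, ?_⟩
    rw [show 2 * (n * u * s) = n * u * (2 * s) by ring, hω, CharTwo.add_cancel_right]
  · intro ω hω
    obtain ⟨t, rfl⟩ := hodd
    have hexp : (ℓ + u) / 2 = u * ((2 * t + 1 + 1) / 2) := by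
      have : ℓ + u = 2 * (u * (t + 1)) := by rw [hL]; ring
      rw [this, show 2 * t + 1 + 1 = 2 * (t + 1) by ring]
      simp
    rw [hq, card_goldCurve hF ⟨t, rfl⟩ hcop hb0 hbq hω, hexp]
    push_cast
    rw [← pow_mul, ← pow_mul, hN, ← mul_assoc n u]
end

section
/- Let p be a prime with p ≡ 1 (mod 4), q = p^n, let ℓ ≥ 2 be odd and r ≥ 0 an integer. Let a, b, c ∈ F_{q^ℓ} with a ≠ 0, let x₀ ∈ F_{q^ℓ} satisfy a^{q^r}·x₀^{q^{2r}} + a·x₀ = −b^{q^r}, and set c₁ = a·x₀^{q^r+1} − c. If T(c₁) = 0, then N_{ℓ,r}(a,b,c) = q^ℓ; otherwise N_{ℓ,r}(a,b,c) = q^ℓ + p^{n(ℓ+1)/2} · η₁(a·T(c₁)), where η₁-values ±1 are read as integers and q^{(ℓ+1)/2} = p^{n(ℓ+1)/2}. -/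
open scoped Classical

section Char
variable {F : Type*} [Field F] [Fintype F]

/-- The quadratic character of a finite field, with values in `ℂ`. -/
noncomputable def complexQuadraticChar (F : Type*) [Field F] [Fintype F] : MulChar F ℂ :=
  (quadraticChar F).ringHomComp (Int.castRingHom ℂ)

theorem complexQuadraticChar_apply (x : F) :
    complexQuadraticChar F x = (quadraticChar F x : ℂ) := rfl

theorem complexQuadraticChar_ne_one (hF : ringChar F ≠ 2) : complexQuadraticChar F ≠ 1 :=
  (MulChar.ringHomComp_ne_one_iff Int.cast_injective).mpr (quadraticChar_ne_one hF)

theorem complexQuadraticChar_isQuadratic : (complexQuadraticChar F).IsQuadratic :=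
  (quadraticChar_isQuadratic F).comp _

theorem gaussSum_complexQuadraticChar_mulShift (hF : ringChar F ≠ 2) (ψ : AddChar F ℂ) (u : F) :
    gaussSum (complexQuadraticChar F) (ψ.mulShift u) =
      complexQuadraticChar F u * gaussSum (complexQuadraticChar F) ψ := by
  rcases eq_or_ne u 0 with rfl | hu
  · simp [gaussSum_one_right (complexQuadraticChar_ne_one hF), MulChar.map_zero]
  · simpa [complexQuadraticChar_isQuadratic.inv] using
      gaussSum_mulShift_eq (complexQuadraticChar F) ψ (Units.mk0 u hu)

/-- A quadratic exponential sum over a finite field is a twisted Gauss sum. -/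
theorem sum_addChar_mul_sq (hF : ringChar F ≠ 2) {ψ : AddChar F ℂ} (hψ : ψ ≠ 1) {u : F}
    (hu : u ≠ 0) :
    ∑ x, ψ (u * x ^ 2) = complexQuadraticChar F u * gaussSum (complexQuadraticChar F) ψ := by
  rw [← gaussSum_complexQuadraticChar_mulShift hF, gaussSum]
  have h1 : ∑ x, ψ (u * x ^ 2) = ∑ y : F, ((quadraticChar F y : ℂ) + 1) * ψ (u * y) := by
    rw [← Finset.sum_fiberwise (g := fun x : F => x ^ 2)]
    refine Finset.sum_congr rfl fun y _ => ?_
    rw [Finset.sum_congr rfl (g := fun _ => ψ (u * y))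
      (fun x hx => by rw [(Finset.mem_filter.mp hx).2]), Finset.sum_const, nsmul_eq_mul]
    congr 1
    have := quadraticChar_card_sqrts hF y
    rw [Set.toFinset_ofPred] at this
    exact_mod_cast this
  have h2 : ∑ y, ψ (u * y) = 0 :=
    AddChar.sum_eq_zero_of_ne_one (AddChar.IsPrimitive.of_ne_one hψ hu)
  simp only [h1, add_mul, one_mul, Finset.sum_add_distrib, h2, add_zero]
  rfl

theorem card_mul_card_fiber {α : Type*} [Fintype α] {ψ : AddChar F ℂ} (hψ : ψ ≠ 1)
    (h : α → F) (t : F) :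
    (Fintype.card F : ℂ) * (Fintype.card {x // h x = t}) = ∑ s, ∑ x, ψ (s * (h x - t)) := by
  rw [Finset.sum_comm]
  simp_rw [AddChar.sum_mulShift _ (AddChar.IsPrimitive.of_ne_one hψ), sub_eq_zero]
  simp [Fintype.card_subtype, ← Finset.sum_filter, mul_comm]

theorem sum_pow_eq_sum_sq {M : Type*} [AddCommMonoid M] {k : ℕ}
    (hk : Nat.Coprime (Fintype.card F - 1) k) (hk0 : k ≠ 0) (h : F → M) :
    ∑ x, h (x ^ (2 * k)) = ∑ x, h (x ^ 2) := by
  have hinj : Function.Injective fun x : F => x ^ k := by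
    intro x y hxy
    simp only at hxy
    rcases eq_or_ne x 0 with rfl | hx
    · rw [zero_pow hk0] at hxy
      exact (pow_eq_zero_iff hk0 |>.mp hxy.symm).symm
    have hy : y ≠ 0 := by
      rintro rfl
      rw [zero_pow hk0] at hxy
      exact hx (pow_eq_zero_iff hk0 |>.mp hxy)
    have hc : (Nat.card Fˣ).Coprime k := by rwa [Nat.card_eq_fintype_card, Fintype.card_units]
    have := (powCoprime hc).injective (a₁ := Units.mk0 x hx) (a₂ := Units.mk0 y hy)
      (Units.ext (by simpa using hxy))
    simpa using congrArg Units.val this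
  refine Fintype.sum_bijective _ (Finite.injective_iff_bijective.mp hinj) _ _ fun x => ?_
  rw [← pow_mul, mul_comm]

end Char

section Extension
variable {K F : Type*} [Field K] [Field F] [Fintype F] [Algebra K F]

theorem isSquare_algebraMap_iff_of_odd_finrank (hodd : Odd (Module.finrank K F)) (s : K) :
    IsSquare (algebraMap K F s) ↔ IsSquare s := by
  refine ⟨fun ⟨u, hu⟩ => ?_, fun h => h.map _⟩
  obtain ⟨m, hm⟩ := hodd
  have h1 : s ^ (2 * m + 1) = Algebra.norm K u * Algebra.norm K u := by
    rw [← map_mul, ← hu, Algebra.norm_algebraMap, hm]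
  rcases eq_or_ne s 0 with rfl | hs
  · exact IsSquare.zero
  refine ⟨Algebra.norm K u / s ^ m, ?_⟩
  field_simp
  rw [pow_two (Algebra.norm K u), ← h1]
  ring

/-- The discriminant of an orthogonal family for the trace form is a square in the extension. -/
theorem isSquare_prod_trace_sq (b : Fin (Module.finrank K F) → F)
    (hb : ∀ i j, i ≠ j → Algebra.trace K F (b i * b j) = 0) :
    IsSquare (algebraMap K F (∏ i, Algebra.trace K F (b i ^ 2))) := by
  have e : Fin (Module.finrank K F) ≃ Gal(F/K) :=
    Fintype.equivOfCardEq (by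
      rw [Fintype.card_fin, ← Nat.card_eq_fintype_card, IsGalois.card_aut_eq_finrank])
  let M : Matrix (Fin (Module.finrank K F)) (Fin (Module.finrank K F)) F :=
    Matrix.of fun i j => e j (b i)
  have hM : M * M.transpose =
      Matrix.diagonal fun i => algebraMap K F (Algebra.trace K F (b i ^ 2)) := by
    ext i j
    have : (M * M.transpose) i j = algebraMap K F (Algebra.trace K F (b i * b j)) := by
      rw [trace_eq_sum_automorphisms, Matrix.mul_apply, ← e.sum_comp]
      simp [M]
    rw [this, Matrix.diagonal_apply]
    split_ifs with h
    · rw [h, pow_two]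
    · rw [hb i j h, map_zero]
  refine ⟨M.det, ?_⟩
  rw [map_prod, ← Matrix.det_diagonal, ← hM, Matrix.det_mul, Matrix.det_transpose]

variable [Fintype K]

theorem quadraticChar_algebraMap_of_odd_finrank (hodd : Odd (Module.finrank K F)) (s : K) :
    quadraticChar F (algebraMap K F s) = quadraticChar K s := by
  simp [quadraticChar_apply, quadraticCharFun, isSquare_algebraMap_iff_of_odd_finrank hodd]

/-- Additive Hilbert 90 for finite fields, in counting form. -/
theorem card_pow_card_sub_self_eq (z : F) :
    Fintype.card {y : F // y ^ Fintype.card K - y = z} =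
      if Algebra.trace K F z = 0 then Fintype.card K else 0 := by
  let L : F →ₗ[K] F := (FiniteField.frobeniusAlgHom K F).toLinearMap - LinearMap.id
  have hL (y : F) : L y = y ^ Fintype.card K - y := rfl
  have hle : LinearMap.range L ≤ LinearMap.ker (Algebra.trace K F) := by
    rintro _ ⟨y, rfl⟩
    rw [LinearMap.mem_ker, hL, map_sub, sub_eq_zero]
    exact Algebra.trace_eq_of_algEquiv (FiniteField.frobeniusAlgEquivOfAlgebraic K F) y
  have htr := (Algebra.trace K F).finrank_range_add_finrank_ker
  rw [LinearMap.range_eq_top.mpr (Algebra.trace_surjective K F), finrank_top,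
    Module.finrank_self] at htr
  have hLr := L.finrank_range_add_finrank_ker
  have hcard : Nat.card (LinearMap.ker L) ≤ Fintype.card K := by
    let P : Polynomial F := Polynomial.X ^ Fintype.card K - Polynomial.X
    have hsub : ((LinearMap.ker L : Submodule K F) : Set F) ⊆ (P.roots.toFinset : Set F) := by
      intro y hy
      have hP : P ≠ 0 := FiniteField.X_pow_card_sub_X_ne_zero F Fintype.one_lt_card
      simpa [hP, P, Polynomial.IsRoot.def, ← hL] using hy
    calc Nat.card (LinearMap.ker L) ≤ Nat.card (P.roots.toFinset : Set F) :=
          Nat.card_mono (Set.toFinite _) hsub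
      _ ≤ P.natDegree := by
          rw [Nat.card_coe_set_eq, Set.ncard_coe_finset]
          exact (Multiset.toFinset_card_le _).trans (Polynomial.card_roots' P)
      _ = Fintype.card K := FiniteField.X_pow_card_sub_X_natDegree_eq F Fintype.one_lt_card
  have hpow : Nat.card (LinearMap.ker L) = Fintype.card K ^ Module.finrank K (LinearMap.ker L) := by
    rw [Module.natCard_eq_pow_finrank (K := K), Nat.card_eq_fintype_card]
  have hker1 : Module.finrank K (LinearMap.ker L) ≤ 1 := by
    rw [hpow] at hcard
    exact (Nat.pow_le_pow_iff_right (Fintype.one_lt_card (α := K))).mp (by simpa using hcard)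
  have hfle := Submodule.finrank_mono hle
  have heq := Submodule.eq_of_le_of_finrank_eq hle (by omega)
  have hker : Nat.card (LinearMap.ker L) = Fintype.card K := by
    rw [hpow, show Module.finrank K (LinearMap.ker L) = 1 by omega, pow_one]
  split_ifs with hz
  · obtain ⟨y₀, hy₀⟩ : z ∈ LinearMap.range L := heq ▸ hz
    refine Eq.trans ?_ hker
    rw [← Nat.card_eq_fintype_card]
    refine Nat.card_congr ⟨fun y => ⟨y.1 - y₀, ?_⟩, fun y => ⟨y.1 + y₀, ?_⟩,
      fun y => by simp, fun y => by simp⟩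
    · rw [LinearMap.mem_ker, map_sub, hy₀, hL, y.2, sub_self]
    · rw [← hL, map_add, hy₀, LinearMap.mem_ker.mp y.2, zero_add]
  · rw [Fintype.card_eq_zero_iff]
    refine ⟨fun y => hz ?_⟩
    have : z ∈ LinearMap.range L := ⟨y.1, y.2⟩
    exact hle this

/-- The Davenport–Hasse relation for the quadratic character in odd degree. -/
theorem sum_addChar_trace_sq_eq_pow (hK : ringChar K ≠ 2) (hodd : Odd (Module.finrank K F))
    {ψ : AddChar K ℂ} (hψ : ψ ≠ 1) :
    ∑ x : F, ψ (Algebra.trace K F (x ^ 2)) =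
      gaussSum (complexQuadraticChar K) ψ ^ Module.finrank K F := by
  have h2 : (2 : K) ≠ 0 := Ring.two_ne_zero hK
  have := invertibleOfNonzero h2
  obtain ⟨v, hv⟩ := LinearMap.BilinForm.exists_orthogonal_basis
    (B := Algebra.traceForm K F) ⟨fun x y => congrArg (Algebra.trace K F) (mul_comm x y)⟩
  have hv' : ∀ i j, i ≠ j → Algebra.trace K F (v i * v j) = 0 := fun i j hij => hv hij
  have hd : ∀ i, Algebra.trace K F (v i ^ 2) ≠ 0 := by
    intro i hi
    refine v.ne_zero i ((traceForm_nondegenerate K F).1 _ fun y => ?_)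
    rw [← v.sum_repr y, map_sum]
    refine Finset.sum_eq_zero fun j _ => ?_
    rw [map_smul, Algebra.traceForm_apply]
    rcases eq_or_ne i j with rfl | hij
    · rw [← pow_two, hi, smul_zero]
    · rw [hv' i j hij, smul_zero]
  have hQ (y : Fin (Module.finrank K F) → K) :
      Algebra.trace K F ((∑ i, y i • v i) ^ 2) =
        ∑ i, Algebra.trace K F (v i ^ 2) * y i ^ 2 := by
    rw [pow_two, Finset.sum_mul_sum, map_sum]
    refine Finset.sum_congr rfl fun i _ => ?_
    rw [map_sum, Finset.sum_eq_single i]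
    · rw [smul_mul_smul_comm, map_smul, smul_eq_mul, ← pow_two, ← pow_two, mul_comm]
    · intro j _ hij
      rw [smul_mul_smul_comm, map_smul, hv' i j hij.symm, smul_zero]
    · simp
  have hψsum (f : Fin (Module.finrank K F) → K) : ψ (∑ i, f i) = ∏ i, ψ (f i) :=
    map_prod ψ.toMonoidHom (fun i => Multiplicative.ofAdd (f i)) Finset.univ
  rw [← v.equivFun.symm.toEquiv.sum_comp]
  simp only [LinearEquiv.coe_toEquiv, Module.Basis.equivFun_symm_apply, hQ, hψsum]
  rw [← Fintype.prod_sum (fun i y => ψ (Algebra.trace K F (v i ^ 2) * y ^ 2))]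
  simp_rw [fun i => sum_addChar_mul_sq hK hψ (hd i)]
  rw [Finset.prod_mul_distrib, Finset.prod_const, Finset.card_univ, Fintype.card_fin, ← map_prod,
    complexQuadraticChar_apply,
    ((quadraticChar_one_iff_isSquare (Finset.prod_ne_zero_iff.mpr fun i _ => hd i)).mpr
      ((isSquare_algebraMap_iff_of_odd_finrank hodd _).mp (isSquare_prod_trace_sq v hv')))]
  simp

theorem trace_pow_card_pow (r : ℕ) (x : F) :
    Algebra.trace K F (x ^ Fintype.card K ^ r) = Algebra.trace K F x := by
  induction r with
  | zero => simp
  | succ r ih =>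
    rw [pow_succ, pow_mul, ← ih]
    exact Algebra.trace_eq_of_algEquiv (FiniteField.frobeniusAlgEquivOfAlgebraic K F) _

/-- Completing the square for the quadratic form `x ↦ tr (a * x ^ (q ^ r + 1))`. -/
theorem trace_add_solution (r : ℕ) {a b x₀ : F} (c : F)
    (hx₀ : a ^ Fintype.card K ^ r * x₀ ^ Fintype.card K ^ (2 * r) + a * x₀ =
      -(b ^ Fintype.card K ^ r)) (x : F) :
    Algebra.trace K F (a * (x + x₀) ^ (Fintype.card K ^ r + 1) + b * (x + x₀) + c) =
      Algebra.trace K F (a * x ^ (Fintype.card K ^ r + 1)) -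
        Algebra.trace K F (a * x₀ ^ (Fintype.card K ^ r + 1) - c) := by
  have hadd (u v : F) :
      (u + v) ^ Fintype.card K ^ r = u ^ Fintype.card K ^ r + v ^ Fintype.card K ^ r := by
    have := map_add ((FiniteField.frobeniusAlgHom K F) ^ r) u v
    simpa [AlgHom.coe_pow, FiniteField.coe_frobeniusAlgHom, pow_iterate] using this
  have hcross (y : F) : Algebra.trace K F (a * y * x₀ ^ Fintype.card K ^ r) +
      Algebra.trace K F (a * y ^ Fintype.card K ^ r * x₀) + Algebra.trace K F (b * y) = 0 := by
    rw [← trace_pow_card_pow r (a * y * x₀ ^ Fintype.card K ^ r), ← trace_pow_card_pow r (b * y),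
      ← map_add, ← map_add, ← map_zero (Algebra.trace K F)]
    congr 1
    rw [mul_pow, mul_pow, mul_pow, ← pow_mul, ← pow_add, ← two_mul]
    linear_combination y ^ Fintype.card K ^ r * hx₀
  have e1 : a * (x + x₀) ^ (Fintype.card K ^ r + 1) + b * (x + x₀) + c =
      a * x ^ (Fintype.card K ^ r + 1) +
        (a * x * x₀ ^ Fintype.card K ^ r + a * x ^ Fintype.card K ^ r * x₀ + b * x) +
        (a * x₀ * x₀ ^ Fintype.card K ^ r + a * x₀ ^ Fintype.card K ^ r * x₀ + b * x₀) -
        (a * x₀ ^ (Fintype.card K ^ r + 1) - c) := by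
    rw [pow_succ, hadd]
    ring
  rw [e1]
  simp only [map_add, map_sub, hcross]
  ring

theorem coprime_card_sub_one_half_card_pow_add_one (hodd : Odd (Module.finrank K F))
    (hK : Fintype.card K % 4 = 1) (r : ℕ) :
    Nat.Coprime (Fintype.card F - 1) ((Fintype.card K ^ r + 1) / 2) := by
  have hmod : Fintype.card K ^ r % 4 = 1 := by
    simp [Nat.pow_mod, hK]
  refine Nat.coprime_of_dvd fun d hd h1 h2 => ?_
  have h3 : (Fintype.card F : ZMod d) = 1 := by
    have := (ZMod.natCast_eq_zero_iff _ d).mpr h1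
    rwa [Nat.cast_sub Fintype.card_pos, sub_eq_zero, Nat.cast_one] at this
  have h4 : (Fintype.card K : ZMod d) ^ r = -1 := by
    have : d ∣ Fintype.card K ^ r + 1 := h2.trans (Nat.div_dvd_of_dvd (by omega))
    have := (ZMod.natCast_eq_zero_iff _ d).mpr this
    push_cast at this
    exact eq_neg_of_add_eq_zero_left this
  have h5 : (1 : ZMod d) = -1 := by
    rw [← hodd.neg_one_pow, ← h4, ← pow_mul, mul_comm, pow_mul, ← Nat.cast_pow,
      ← Module.card_eq_pow_finrank (K := K) (V := F), h3, one_pow]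
  have h6 : d ∣ 2 := by
    rw [← ZMod.natCast_eq_zero_iff]
    push_cast
    linear_combination h5
  rw [(Nat.prime_dvd_prime_iff_eq hd Nat.prime_two).mp h6] at h2
  omega

theorem card_trace_mul_pow_fiber (hodd : Odd (Module.finrank K F)) (hK : Fintype.card K % 4 = 1)
    (r : ℕ) {a : F} (ha : a ≠ 0) (t : K) :
    (Fintype.card K * Fintype.card
      {x : F // Algebra.trace K F (a * x ^ (Fintype.card K ^ r + 1)) = t} : ℤ) =
      Fintype.card F + Fintype.card K ^ ((Module.finrank K F + 1) / 2) *
        quadraticChar F (a * algebraMap K F t) := by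
  have hK2 : ringChar K ≠ 2 := fun h => by
    have := FiniteField.even_card_of_char_two h
    omega
  have hF2 : ringChar F ≠ 2 := by
    rwa [← Algebra.ringChar_eq K F]
  obtain ⟨ψ, hψ⟩ : ∃ ψ : AddChar K ℂ, ψ ≠ 1 := by
    obtain ⟨ψ, hψ⟩ := AddChar.exists_apply_ne_zero.mpr (one_ne_zero (α := K))
    exact ⟨ψ, fun h => hψ (by rw [h]; rfl)⟩
  let Ψ : AddChar F ℂ := ψ.compAddMonoidHom (Algebra.trace K F).toAddMonoidHom
  have hΨa (x : F) : Ψ x = ψ (Algebra.trace K F x) := rfl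
  have hΨ : Ψ ≠ 1 := fun h => hψ <| by
    ext s
    obtain ⟨x, rfl⟩ := Algebra.trace_surjective K F s
    exact DFunLike.congr_fun h x
  set g := gaussSum (complexQuadraticChar K) ψ with hg
  have hG : gaussSum (complexQuadraticChar F) Ψ = g ^ Module.finrank K F := by
    rw [hg, ← sum_addChar_trace_sq_eq_pow hK2 hodd hψ]
    simpa [hΨa] using (sum_addChar_mul_sq hF2 hΨ one_ne_zero).symm
  have hneg : complexQuadraticChar K (-1) = 1 := by
    rw [complexQuadraticChar_apply,
      (quadraticChar_one_iff_isSquare (neg_ne_zero.mpr one_ne_zero)).mpr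
      (FiniteField.isSquare_neg_one_iff.mpr (by omega)), Int.cast_one]
  have hg2 : g ^ 2 = Fintype.card K := by
    rw [gaussSum_sq (complexQuadraticChar_ne_one hK2) complexQuadraticChar_isQuadratic
      (AddChar.IsPrimitive.of_ne_one hψ), hneg, one_mul]
  have hgpow : g ^ (Module.finrank K F) * g =
      (Fintype.card K : ℂ) ^ ((Module.finrank K F + 1) / 2) := by
    rw [← hg2, ← pow_succ, ← pow_mul, Nat.mul_div_cancel' hodd.add_one.two_dvd]
  have hinner (s : K) :
      ∑ x : F, ψ (s * (Algebra.trace K F (a * x ^ (Fintype.card K ^ r + 1)) - t)) =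
        (if s = 0 then (Fintype.card F : ℂ) else 0) +
          complexQuadraticChar F a * g ^ Module.finrank K F *
            (complexQuadraticChar K s * ψ (-t * s)) := by
    rcases eq_or_ne s 0 with rfl | hs
    · simp [MulChar.map_zero]
    have hmod : Fintype.card K ^ r % 4 = 1 := by
      simp [Nat.pow_mod, hK]
    have hk := sum_pow_eq_sum_sq (coprime_card_sub_one_half_card_pow_add_one hodd hK r)
      (by omega) (fun y : F => ψ (s * (Algebra.trace K F (a * y) - t)))
    rw [Nat.mul_div_cancel' (by omega : 2 ∣ Fintype.card K ^ r + 1)] at hk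
    rw [hk, if_neg hs, zero_add, ← hG]
    have hsa : algebraMap K F s * a ≠ 0 :=
      mul_ne_zero ((map_ne_zero _).mpr hs) ha
    have hterm (x : F) : ψ (s * (Algebra.trace K F (a * x ^ 2) - t)) =
        ψ (-t * s) * Ψ (algebraMap K F s * a * x ^ 2) := by
      rw [hΨa, mul_assoc, ← Algebra.smul_def, map_smul, smul_eq_mul, ← AddChar.map_add_eq_mul]
      congr 1
      ring
    simp_rw [hterm, ← Finset.mul_sum]
    rw [sum_addChar_mul_sq hF2 hΨ hsa, map_mul (complexQuadraticChar F),
      complexQuadraticChar_apply (algebraMap K F s),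
      quadraticChar_algebraMap_of_odd_finrank hodd, ← complexQuadraticChar_apply]
    ring
  have hgt : ∑ s, complexQuadraticChar K s * ψ (-t * s) = complexQuadraticChar K t * g := by
    have := gaussSum_complexQuadraticChar_mulShift hK2 ψ (-t)
    rw [← neg_one_mul t, map_mul, hneg, one_mul] at this
    simpa [hg, gaussSum] using this
  have hmain := card_mul_card_fiber hψ
    (fun x : F => Algebra.trace K F (a * x ^ (Fintype.card K ^ r + 1))) t
  simp_rw [hinner] at hmain
  rw [Finset.sum_add_distrib, ← Finset.mul_sum, hgt, Finset.sum_ite_eq' Finset.univ,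
    if_pos (Finset.mem_univ _)] at hmain
  have hcast : (quadraticChar F (a * algebraMap K F t) : ℂ) =
      complexQuadraticChar F a * complexQuadraticChar K t := by
    rw [map_mul, quadraticChar_algebraMap_of_odd_finrank hodd, Int.cast_mul]
    rfl
  rw [← Int.cast_inj (α := ℂ)]
  push_cast
  rw [hcast, hmain, ← hgpow]
  ring

theorem card_artinSchreier_eq (hodd : Odd (Module.finrank K F)) (hK : Fintype.card K % 4 = 1)
    (r : ℕ) {a b x₀ : F} (c : F) (ha : a ≠ 0)
    (hx₀ : a ^ Fintype.card K ^ r * x₀ ^ Fintype.card K ^ (2 * r) + a * x₀ =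
      -(b ^ Fintype.card K ^ r)) :
    (Nat.card {xy : F × F // xy.2 ^ Fintype.card K - xy.2 =
        a * xy.1 ^ (Fintype.card K ^ r + 1) + b * xy.1 + c} : ℤ) =
      Fintype.card F + Fintype.card K ^ ((Module.finrank K F + 1) / 2) *
        quadraticChar F (a * algebraMap K F
          (Algebra.trace K F (a * x₀ ^ (Fintype.card K ^ r + 1) - c))) := by
  rw [← card_trace_mul_pow_fiber hodd hK r ha]
  norm_cast
  let f : F → F := fun x => a * x ^ (Fintype.card K ^ r + 1) + b * x + c
  have e : {xy : F × F // xy.2 ^ Fintype.card K - xy.2 = f xy.1} ≃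
      Σ x : F, {y : F // y ^ Fintype.card K - y = f x} :=
    Equiv.subtypeProdEquivSigmaSubtype fun x y : F => y ^ Fintype.card K - y = f x
  have e' : {x : F // Algebra.trace K F (f x) = 0} ≃
      {x : F // Algebra.trace K F (a * x ^ (Fintype.card K ^ r + 1)) =
        Algebra.trace K F (a * x₀ ^ (Fintype.card K ^ r + 1) - c)} :=
    ((Equiv.addRight x₀).subtypeEquiv fun x => by
      rw [Equiv.coe_addRight, trace_add_solution r c hx₀, sub_eq_zero]).symm
  rw [← Fintype.card_congr e', Nat.card_congr e, Nat.card_eq_fintype_card, Fintype.card_sigma]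
  simp_rw [card_pow_card_sub_self_eq]
  simp [← Finset.sum_filter, Fintype.card_subtype, mul_comm]

end Extension


/-- Let `p ≡ 1 (mod 4)` be prime, `q = p ^ n`, `ℓ ≥ 2` odd, `r ≥ 0`.
Let `a, b, c ∈ F_{q^ℓ}` with `a ≠ 0`, let `x₀` solve `a^(q^r) x^(q^(2r)) + a x = -b^(q^r)`
and set `c₁ = a x₀^(q^r+1) - c`.  If `T(c₁) = 0` then `N_{ℓ,r}(a,b,c) = q^ℓ`; otherwise
`N_{ℓ,r}(a,b,c) = q^ℓ + p^(n(ℓ+1)/2) · η₁(a · T(c₁))`, where `η₁` is the quadratic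
character of `F_{q^ℓ}`. -/
theorem stmt_5 (p n : ℕ) (hp : p.Prime) (hp1 : p % 4 = 1) (hn : 1 ≤ n)
    (q : ℕ) (hq : q = p ^ n)
    (ℓ r : ℕ) (hℓ : 2 ≤ ℓ) (hlo : Odd ℓ)
    (F : Type) [Field F] [Fintype F] (hF : Fintype.card F = q ^ ℓ)
    (T : F → F) (hT : ∀ z : F, T z = ∑ i ∈ Finset.range ℓ, z ^ q ^ i)
    (η : F → ℤ) (hη : ∀ z : F, η z = if z = 0 then 0 else if IsSquare z then 1 else -1)
    (a b c x₀ c₁ : F) (ha : a ≠ 0)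
    (hx₀ : a ^ q ^ r * x₀ ^ q ^ (2 * r) + a * x₀ = -(b ^ q ^ r))
    (hc₁ : c₁ = a * x₀ ^ (q ^ r + 1) - c) :
    (T c₁ = 0 →
      Nat.card {xy : F × F //
          xy.2 ^ q - xy.2 = a * xy.1 ^ (q ^ r + 1) + b * xy.1 + c} = q ^ ℓ) ∧
    (T c₁ ≠ 0 →
      (Nat.card {xy : F × F //
          xy.2 ^ q - xy.2 = a * xy.1 ^ (q ^ r + 1) + b * xy.1 + c} : ℤ)
        = (q : ℤ) ^ ℓ + (p : ℤ) ^ (n * ((ℓ + 1) / 2)) * η (a * T c₁)) := by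
  have := Fact.mk hp
  have hn0 : n ≠ 0 := by omega
  have hchar : CharP F p := charP_of_card_eq_prime_pow (f := n * ℓ) (by rw [hF, hq, pow_mul])
  let _ : Algebra (ZMod p) F := ZMod.algebra F p
  have hfin : Module.finrank (ZMod p) F = n * ℓ := by
    refine Nat.pow_right_injective hp.two_le ?_
    simp only
    rw [FiniteField.pow_finrank_eq_card, hF, hq, pow_mul]
  let K := GaloisField p n
  let _ : Fintype K := Fintype.ofFinite K
  obtain ⟨φ⟩ := FiniteField.nonempty_algHom_of_finrank_dvd (F := ZMod p) (K := K) (L := F)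
    (by rw [GaloisField.finrank p hn0, hfin]; exact dvd_mul_right n ℓ)
  let _ : Algebra K F := φ.toRingHom.toAlgebra
  have hKq : Fintype.card K = q := by
    rw [← Nat.card_eq_fintype_card, GaloisField.card p n hn0, hq]
  have hKF : Module.finrank K F = ℓ := by
    refine Nat.pow_right_injective (hKq ▸ Fintype.one_lt_card : 2 ≤ q) ?_
    simp only
    rw [← hF, Module.card_eq_pow_finrank (K := K) (V := F), hKq]
  have hT' (z : F) : algebraMap K F (Algebra.trace K F z) = T z := by
    rw [FiniteField.algebraMap_trace_eq_sum_pow, hT, hKF, Nat.card_eq_fintype_card, hKq]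
  have hη' (z : F) : η z = quadraticChar F z := by
    rw [hη, quadraticChar_apply, quadraticCharFun]
  have hq4 : q % 4 = 1 := by
    rw [hq, Nat.pow_mod, hp1, one_pow]
    rfl
  have hmain := card_artinSchreier_eq (K := K) (hKF ▸ hlo) (hKq ▸ hq4) r c ha (hKq ▸ hx₀)
  rw [hT', ← hη', hKF, hKq, hF, ← hc₁, Nat.cast_pow] at hmain
  refine ⟨fun h => ?_, fun _ => ?_⟩
  · rw [h, mul_zero, hη, if_pos rfl, mul_zero, add_zero] at hmain
    exact_mod_cast hmain
  · rw [hmain, pow_mul, ← Nat.cast_pow p n, ← hq]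
end

section
/- Let p > 2 be a prime, q = p^n, and let ℓ ≥ 2 be even and r ≥ 0 an integer such that ℓ/u is odd, where u = gcd(ℓ, r) (with u = ℓ when r = 0). Let a, b, c ∈ F_{q^ℓ} with a ≠ 0, let x₀ ∈ F_{q^ℓ} satisfy a^{q^r}·x₀^{q^{2r}} + a·x₀ = −b^{q^r}, and set c₁ = a·x₀^{q^r+1} − c. Then: (i) if p ≡ 1 (mod 4) and T(c₁) = 0, then N_{ℓ,r}(a,b,c) = q^ℓ − q^{ℓ/2}(q−1)·η₁(a); (ii) if p ≡ 1 (mod 4) and T(c₁) ≠ 0, then N_{ℓ,r}(a,b,c) = q^ℓ + q^{ℓ/2}·η₁(a); (iii) if p ≡ 3 (mod ,4) and T(c₁) = 0, then N_{ℓ,r}(a,b,c) = q^ℓ + (−1)^{1+nℓ/2} q^{ℓ/2}(q−1)·η₁(a); (iv) if p ≡ 3 (mod 4) and T(c₁) ≠ 0, then N_{ℓ,r}(a,b,c) = q^ℓ + (−1)^{nℓ/2} q^{ℓ/2}·η₁(a). Here η₁-values ±1 are read as integers. -/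
open scoped Classical

open Finset Polynomial

theorem card_fiber_eq_of_le {α β : Type*} (s : Finset α) (t : Finset β) (f : α → β) (k : ℕ)
    (hmap : ∀ x ∈ s, f x ∈ t) (hle : ∀ y ∈ t, #{x ∈ s | f x = y} ≤ k)
    (hcard : k * #t ≤ #s) : ∀ y ∈ t, #{x ∈ s | f x = y} = k := by
  by_contra! h
  obtain ⟨y, hy, hne⟩ := h
  have h1 : ∑ y ∈ t, #{x ∈ s | f x = y} < ∑ _y ∈ t, k :=
    sum_lt_sum hle ⟨y, hy, lt_of_le_of_ne (hle y hy) hne⟩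
  rw [← card_eq_sum_card_fiberwise hmap, sum_const, smul_eq_mul, mul_comm] at h1
  omega

theorem gcd_pow_add_one_pow_sub_one {q ℓ r : ℕ} (hq : Odd q) (hℓ : ℓ ≠ 0)
    (hodd : Odd (ℓ / Nat.gcd ℓ r)) : Nat.gcd (q ^ r + 1) (q ^ ℓ - 1) = 2 := by
  have hq0 : 0 < q := hq.pos
  set u := Nat.gcd ℓ r with hu
  have hu0 : 0 < u := Nat.gcd_pos_of_pos_left _ (Nat.pos_of_ne_zero hℓ)
  have hgcd : Nat.gcd (2 * r) ℓ = u := by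
    obtain ⟨R, hR⟩ : u ∣ r := Nat.gcd_dvd_right _ _
    obtain ⟨L, hL⟩ : u ∣ ℓ := Nat.gcd_dvd_left _ _
    rw [hL, Nat.mul_div_cancel_left _ hu0] at hodd
    have hco : Nat.gcd L R = 1 := by
      rw [hL, hR, Nat.gcd_mul_left] at hu
      exact Nat.eq_of_mul_eq_mul_left hu0 (by omega)
    rw [hR, hL, mul_left_comm, Nat.gcd_mul_left,
      Nat.Coprime.gcd_mul_left_cancel _ hodd.coprime_two_left, Nat.gcd_comm, hco, mul_one]
  apply Nat.dvd_antisymm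
  · set d := Nat.gcd (q ^ r + 1) (q ^ ℓ - 1)
    have h1 : d ∣ q ^ r + 1 := Nat.gcd_dvd_left _ _
    have h2 : d ∣ q ^ (2 * r) - 1 := by
      rw [mul_comm, pow_mul]
      have : (q ^ r) ^ 2 - 1 = (q ^ r + 1) * (q ^ r - 1) := by
        simpa using Nat.sq_sub_sq (q ^ r) 1
      exact this ▸ h1.mul_right _
    have h3 : d ∣ q ^ u - 1 := by
      rw [← hgcd, ← Nat.pow_sub_one_gcd_pow_sub_one]
      exact Nat.dvd_gcd h2 (Nat.gcd_dvd_right _ _)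
    have h4 : d ∣ q ^ r - 1 := h3.trans (Nat.pow_sub_one_dvd_pow_sub_one _ (Nat.gcd_dvd_right _ _))
    have h5 := Nat.dvd_sub h1 h4
    have : 0 < q ^ r := Nat.pow_pos hq0
    rwa [show q ^ r + 1 - (q ^ r - 1) = 2 by omega] at h5
  · refine Nat.dvd_gcd ?_ ?_
    · exact (hq.pow.add_odd odd_one).two_dvd
    · exact (Nat.Odd.sub_odd hq.pow odd_one).two_dvd

theorem neg_one_pow_of_mod_four_eq_three {p k H : ℕ} (hp : p % 4 = 3) (hH : p ^ k + 1 = 2 * H) :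
    (-1 : ℤ) ^ H = (-1) ^ (1 + k) := by
  rcases Nat.even_or_odd' k with ⟨j, rfl | rfl⟩
  · have h : p ^ (2 * j) % 4 = 1 := by
      rw [pow_mul, Nat.pow_mod, Nat.pow_mod p, hp]; simp
    have : Odd H := Nat.odd_iff.2 (by omega)
    rw [this.neg_one_pow, Odd.neg_one_pow (by simp)]
  · have h : p ^ (2 * j + 1) % 4 = 3 := by
      rw [pow_succ, Nat.mul_mod, pow_mul, Nat.pow_mod, Nat.pow_mod p, hp]; simp
    have : Even H := Nat.even_iff.2 (by omega)
    rw [this.neg_one_pow, Even.neg_one_pow ⟨j + 1, by ring⟩]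

section FiniteField

variable {F : Type} [Field F] {p n q : ℕ}

/-- The sum `z + z ^ q + ⋯ + z ^ q ^ (m - 1)`. -/
def powTrace (q m : ℕ) (z : F) : F := ∑ i ∈ range m, z ^ q ^ i

theorem powTrace_add (hp : p.Prime) [CharP F p] (hq : q = p ^ n) (m : ℕ) (x y : F) :
    powTrace q m (x + y) = powTrace q m x + powTrace q m y := by
  have := Fact.mk hp
  simp only [powTrace, ← sum_add_distrib, hq, ← pow_mul, add_pow_char_pow]

theorem powTrace_neg (hp : p.Prime) [CharP F p] (hq : q = p ^ n) (m : ℕ) (x : F) :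
    powTrace q m (-x) = -powTrace q m x := by
  have h := powTrace_add hp hq m x (-x)
  rw [add_neg_cancel] at h
  have h0 : powTrace q m (0 : F) = 0 := by
    apply sum_eq_zero
    intro i _
    apply zero_pow
    rw [hq]
    exact pow_ne_zero _ (pow_ne_zero _ hp.ne_zero)
  rw [h0] at h
  linear_combination -h

theorem powTrace_pow (m : ℕ) {x : F} (hx : x ^ q ^ m = x) :
    powTrace q m (x ^ q) = powTrace q m x := by
  have h : ∑ i ∈ range (m + 1), x ^ q ^ i = ∑ i ∈ range (m + 1), x ^ q ^ i := rfl
  conv_lhs at h => rw [sum_range_succ']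
  rw [sum_range_succ, hx] at h
  simp only [pow_zero, pow_one] at h
  simp only [powTrace, ← pow_mul, ← pow_succ']
  exact add_right_cancel h

theorem powTrace_pow' (m : ℕ) (h : ∀ x : F, x ^ q ^ m = x) (r : ℕ) (x : F) :
    powTrace q m (x ^ q ^ r) = powTrace q m x := by
  induction r with
  | zero => simp
  | succ r ih => rw [pow_succ, pow_mul, powTrace_pow m (h _), ih]

theorem pow_powTrace (hp : p.Prime) [CharP F p] (hq : q = p ^ n) (m : ℕ) {x : F}
    (hx : x ^ q ^ m = x) : powTrace q m x ^ q = powTrace q m x := by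
  have := Fact.mk hp
  refine Eq.trans ?_ (powTrace_pow m hx)
  rw [powTrace, powTrace, hq, sum_pow_char_pow]
  refine sum_congr rfl fun i _ => ?_
  rw [← pow_mul, mul_comm, pow_mul]

theorem powTrace_two_mul (hp : p.Prime) [CharP F p] (hq : q = p ^ n) (m : ℕ) (x : F) :
    powTrace q (2 * m) x = powTrace q m (x + x ^ q ^ m) := by
  rw [powTrace_add hp hq, two_mul, powTrace, sum_range_add]
  simp only [powTrace, ← pow_mul, ← pow_add]

theorem powTrace_shift (hp : p.Prime) [CharP F p] (hq : q = p ^ n) {ℓ r : ℕ}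
    (hfr : ∀ x : F, x ^ q ^ ℓ = x) {a b c x₀ : F}
    (hx₀ : a ^ q ^ r * x₀ ^ q ^ (2 * r) + a * x₀ = -(b ^ q ^ r)) (z : F) :
    powTrace q ℓ (a * (z + x₀) ^ (q ^ r + 1) + b * (z + x₀) + c) =
      powTrace q ℓ (a * z ^ (q ^ r + 1)) - powTrace q ℓ (a * x₀ ^ (q ^ r + 1) - c) := by
  have := Fact.mk hp
  have hadd := powTrace_add (F := F) hp hq ℓ
  have hneg := powTrace_neg (F := F) hp hq ℓ
  have hpow : ∀ y z : F, (y + z) ^ q ^ r = y ^ q ^ r + z ^ q ^ r := fun y z => by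
    rw [hq, ← pow_mul, add_pow_char_pow]
  have h2r : ∀ y : F, (y ^ q ^ r) ^ q ^ r = y ^ q ^ (2 * r) := fun y => by
    rw [← pow_mul, ← pow_add, two_mul]
  have hlin : powTrace q ℓ ((a * x₀ ^ q ^ r + b) * z) = -powTrace q ℓ (a * x₀ * z ^ q ^ r) := by
    rw [← powTrace_pow' ℓ hfr r, ← hneg]
    congr 1
    rw [mul_pow, hpow, mul_pow, h2r]
    linear_combination z ^ q ^ r * hx₀
  have hconst : powTrace q ℓ (b * x₀) =
      -(powTrace q ℓ (a * x₀ ^ (q ^ r + 1)) + powTrace q ℓ (a * x₀ ^ (q ^ r + 1))) := by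
    rw [← powTrace_pow' ℓ hfr r]
    conv_rhs => enter [1, 1]; rw [← powTrace_pow' ℓ hfr r]
    rw [← hadd, ← hneg]
    congr 1
    rw [mul_pow, mul_pow a, pow_succ x₀, mul_pow (x₀ ^ q ^ r), h2r]
    linear_combination x₀ ^ q ^ r * hx₀
  have hexp : a * (z + x₀) ^ (q ^ r + 1) + b * (z + x₀) + c =
      a * z ^ (q ^ r + 1) + a * x₀ * z ^ q ^ r + (a * x₀ ^ q ^ r + b) * z
        + a * x₀ ^ (q ^ r + 1) + b * x₀ + c := by
    rw [pow_succ (z + x₀), hpow]; ring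
  rw [hexp, sub_eq_add_neg (a * x₀ ^ (q ^ r + 1)), hadd, hadd, hadd, hadd, hadd, hadd, hneg,
    hlin, hconst]
  ring

variable [Fintype F]

theorem card_filter_X_pow_add_eval_le (k : ℕ) (P : F[X]) (hP : P.degree < k) :
    #{x : F | x ^ k + P.eval x = 0} ≤ k := by
  have hm : (X ^ k + P).Monic := monic_X_pow_add hP
  have hd : (X ^ k + P).natDegree = k := by
    apply natDegree_eq_of_degree_eq_some
    rw [degree_add_eq_left_of_degree_lt] <;> simp [hP]
  calc _ ≤ #(X ^ k + P).roots.toFinset := by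
        apply card_le_card
        intro x hx
        simp only [mem_filter, mem_univ, true_and] at hx
        simp [hm.ne_zero, hx]
    _ ≤ _ := (Multiset.toFinset_card_le _).trans ((card_roots' _).trans hd.le)

theorem card_powTrace_fiber_le {m : ℕ} (hq : 1 < q) (hm : 0 < m) (t : F) :
    #{x : F | powTrace q m x = t} ≤ q ^ (m - 1) := by
  obtain ⟨k, rfl⟩ := Nat.exists_eq_add_of_lt hm
  simp only [zero_add, Nat.add_sub_cancel]
  have h := card_filter_X_pow_add_eval_le (F := F) (q ^ k)
    (∑ i ∈ range k, X ^ q ^ i - C t) (by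
      refine (degree_sub_le _ _).trans_lt (max_lt ?_ ?_)
      · refine (degree_sum_le _ _).trans_lt ?_
        rw [Finset.sup_lt_iff (by exact WithBot.bot_lt_coe _)]
        intro i hi
        rw [degree_X_pow]
        exact_mod_cast Nat.pow_lt_pow_right hq (mem_range.1 hi)
      · refine degree_C_le.trans_lt ?_
        exact_mod_cast Nat.pow_pos (by omega))
  convert h using 3
  simp only [powTrace, sum_range_succ, eval_sub, eval_finsetSum, eval_pow, eval_X, eval_C]
  constructor
  · intro h; rw [← h]; ring
  · intro h; linear_combination h

theorem card_pow_fiber_le {k : ℕ} (hk : 0 < k) (t : F) : #{x : F | x ^ k = t} ≤ k := by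
  have h := card_filter_X_pow_add_eval_le (F := F) k (-C t) (by
    rw [degree_neg]; refine degree_C_le.trans_lt ?_; exact_mod_cast hk)
  simpa [← sub_eq_add_neg, sub_eq_zero] using h

theorem card_pow_sub_self_fiber_le (hq : 1 < q) (t : F) :
    #{x : F | x ^ q - x = t} ≤ q := by
  have h := card_filter_X_pow_add_eval_le (F := F) q (-(X + C t)) (by
    rw [degree_neg, degree_X_add_C]; exact_mod_cast hq)
  convert h using 3
  simp only [eval_neg, eval_add, eval_X, eval_C]
  constructor <;> intro h <;> linear_combination h

theorem card_pow_sub_self_fiber (hp : p.Prime) [CharP F p] (hq : q = p ^ n) (hn : 1 ≤ n)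
    {ℓ : ℕ} (hℓ : 0 < ℓ) (hF : Fintype.card F = q ^ ℓ) (w : F) :
    #{y : F | y ^ q - y = w} = if powTrace q ℓ w = 0 then q else 0 := by
  have hq1 : 1 < q := hq ▸ Nat.one_lt_pow (by omega) hp.one_lt
  have hfr : ∀ x : F, x ^ q ^ ℓ = x := fun x => hF ▸ FiniteField.pow_card x
  have hz : ∀ y : F, powTrace q ℓ (y ^ q - y) = 0 := fun y => by
    rw [sub_eq_add_neg, powTrace_add hp hq, powTrace_neg hp hq, powTrace_pow ℓ (hfr y),
      add_neg_cancel]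
  split_ifs with h
  · refine card_fiber_eq_of_le univ {w : F | powTrace q ℓ w = 0} (fun y => y ^ q - y) q
      (fun y _ => by simp [hz]) (fun y _ => card_pow_sub_self_fiber_le hq1 y) ?_ w (by simp [h])
    calc _ ≤ q * q ^ (ℓ - 1) := Nat.mul_le_mul_left _ (card_powTrace_fiber_le hq1 hℓ _)
      _ = _ := by rw [card_univ, hF, mul_pow_sub_one hℓ.ne']
  · rw [card_eq_zero, filter_eq_empty_iff]
    rintro y - rfl
    exact h (hz y)

theorem card_fixed (hp : p.Prime) [CharP F p] (hq : q = p ^ n) (hn : 1 ≤ n)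
    {ℓ : ℕ} (hℓ : 0 < ℓ) (hF : Fintype.card F = q ^ ℓ) : #{y : F | y ^ q = y} = q := by
  have h := card_pow_sub_self_fiber hp hq hn hℓ hF (0 : F)
  have h0 : powTrace q ℓ (0 : F) = 0 := by
    simpa using powTrace_add hp hq ℓ (0 : F) 0
  simpa [h0, sub_eq_zero] using h

theorem card_powTrace_fiber (hp : p.Prime) [CharP F p] (hq : q = p ^ n) (hn : 1 ≤ n)
    {m : ℕ} (hm : 0 < m) (hF : Fintype.card F = q ^ (2 * m)) {t : F} (ht : t ^ q = t) :
    #{s : F | s ^ q ^ m = s ∧ powTrace q m s = t} = q ^ (m - 1) := by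
  have hq1 : 1 < q := hq ▸ Nat.one_lt_pow (by omega) hp.one_lt
  rw [← filter_filter]
  refine card_fiber_eq_of_le ({s : F | s ^ q ^ m = s} : Finset F) {t : F | t ^ q = t}
    (powTrace q m) _ ?_ ?_ ?_ t (by simp [ht])
  · intro x hx
    simp only [mem_filter, mem_univ, true_and] at hx ⊢
    exact pow_powTrace hp hq m hx
  · intro y _
    refine (card_le_card ?_).trans (card_powTrace_fiber_le hq1 hm y)
    exact filter_subset_filter _ (subset_univ _)
  · rw [card_fixed hp hq hn (by omega) hF,
      card_fixed (q := q ^ m) (n := n * m) (ℓ := 2) hp (by rw [hq, pow_mul])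
        (Nat.mul_pos hn hm) two_pos (by rw [hF, ← pow_mul, mul_comm]),
      pow_sub_one_mul hm.ne']

theorem card_pow_fiber {k N : ℕ} (hN : 0 < k * N) (hF : Fintype.card F = k * N + 1)
    {g : F} (hg : g ≠ 0) : #{x : F | x ^ k = g} = if g ^ N = 1 then k else 0 := by
  have hk : 0 < k := Nat.pos_of_mul_pos_right hN
  have hN' : 0 < N := Nat.pos_of_mul_pos_left hN
  have h1 : ∀ x : F, x ≠ 0 → (x ^ k) ^ N = 1 := fun x hx => by
    rw [← pow_mul]
    have := FiniteField.pow_card_sub_one_eq_one x hx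
    rwa [hF, Nat.add_sub_cancel] at this
  split_ifs with h
  · have := card_fiber_eq_of_le ({x : F | x ≠ 0} : Finset F) {g : F | g ^ N = 1} (· ^ k) k
      (fun x hx => by simpa using h1 x (by simpa using hx))
      (fun y _ => (card_le_card (filter_subset_filter _ (subset_univ _))).trans
        (card_pow_fiber_le hk y)) ?_ g (by simp [h])
    · rw [filter_filter] at this
      refine Eq.trans ?_ this
      congr 1
      ext x
      simp only [mem_filter, mem_univ, true_and]
      constructor
      · rintro rfl
        exact ⟨fun h0 => hg (by rw [h0, zero_pow hk.ne']), rfl⟩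
      · exact And.right
    · have : #({x : F | x ≠ 0} : Finset F) = k * N := by
        rw [filter_ne', card_erase_of_mem (mem_univ _), card_univ, hF, Nat.add_sub_cancel]
      rw [this]
      exact Nat.mul_le_mul_left _ (card_pow_fiber_le hN' 1)
  · rw [card_eq_zero, filter_eq_empty_iff]
    rintro y - rfl
    exact h (h1 y (fun h0 => hg (by rw [h0, zero_pow hk.ne'])))

theorem card_sq_add_pow_eq_zero {Q H : ℕ} (hH : Q + 1 = 2 * H) (hQ : 1 < Q)
    (hF : Fintype.card F = Q ^ 2) {a : F} (ha : a ≠ 0) {ε : ℤ} (hε : ε = 1 ∨ ε = -1)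
    (hεa : (ε : F) = (-1) ^ H * a ^ ((Q - 1) * H)) (h2 : (2 : F) ≠ 0) :
    (#{x : F | a * x ^ 2 + (a * x ^ 2) ^ Q = 0} : ℤ) = 1 + (Q - 1) * (1 + ε) := by
  obtain ⟨R, rfl⟩ : ∃ R, Q = R + 1 := ⟨Q - 1, by omega⟩
  simp only [Nat.add_sub_cancel] at hεa
  have haR : a ^ R ≠ 0 := pow_ne_zero _ ha
  have hset : ({x : F | a * x ^ 2 + (a * x ^ 2) ^ (R + 1) = 0} : Finset F) =
      insert 0 ({x : F | x ^ (2 * R) = -(a ^ R)⁻¹} : Finset F) := by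
    ext x
    simp only [mem_filter, mem_univ, true_and, mem_insert]
    have hfac : a * x ^ 2 + (a * x ^ 2) ^ (R + 1)
        = a * x ^ 2 * (a ^ R * (x ^ (2 * R) + (a ^ R)⁻¹)) := by
      rw [mul_add, mul_inv_cancel₀ haR]; ring
    rw [hfac, eq_neg_iff_add_eq_zero]
    simp [ha, haR]
  have hcard := card_pow_fiber (F := F) (k := 2 * R) (N := H) (g := -(a ^ R)⁻¹)
    (by apply Nat.mul_pos <;> omega) (by
      have h : 2 * R * H = R * (R + 2) := by
        rw [mul_right_comm, ← hH]; ring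
      rw [hF, h]; ring) (neg_ne_zero.2 (inv_ne_zero haR))
  have hg : (-(a ^ R)⁻¹) ^ H = 1 ↔ ε = 1 := by
    have h1 : (-(a ^ R)⁻¹) ^ H = (ε : F)⁻¹ := by
      rw [hεa, neg_pow, mul_inv, inv_pow, pow_mul, ← inv_pow (-1 : F), inv_neg, inv_one]
    rw [h1]
    rcases hε with rfl | rfl
    · simp
    · simp only [Int.cast_neg, Int.cast_one, inv_neg, inv_one]
      constructor
      · intro h
        exact absurd (by linear_combination -h) h2
      · intro h; omega
  rw [hset, card_insert_of_notMem, hcard]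
  · simp only [hg]
    rcases hε with rfl | rfl
    · simp; ring
    · simp
  · simp only [mem_filter, mem_univ, true_and]
    rw [zero_pow (by omega)]
    intro h
    exact inv_ne_zero haR (neg_eq_zero.1 h.symm)

theorem card_sq_add_pow_eq {Q H : ℕ} (hH : Q + 1 = 2 * H) (hQ : 1 < Q)
    (hF : Fintype.card F = Q ^ 2) {a : F} (ha : a ≠ 0) {ε : ℤ} (hε : ε = 1 ∨ ε = -1)
    (hεa : (ε : F) = (-1) ^ H * a ^ ((Q - 1) * H)) (h2 : (2 : F) ≠ 0)
    (hE : #{s : F | s ^ Q = s} = Q)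
    (hmap : ∀ x : F, (x + x ^ Q) ^ Q = x + x ^ Q) {s : F} (hs : s ^ Q = s) (hs0 : s ≠ 0) :
    (#{x : F | a * x ^ 2 + (a * x ^ 2) ^ Q = s} : ℤ) = Q - ε := by
  have key : ∀ s : F, s ^ Q = s → s ≠ 0 →
      #{x : F | a * x ^ 2 + (a * x ^ 2) ^ Q = s} =
        #{x : F | a * x ^ 2 + (a * x ^ 2) ^ Q = 1} := by
    intro s hs hs0
    have hsq : IsSquare s := by
      rw [FiniteField.isSquare_iff (fun h => h2 (by
        have := ringChar.Nat.cast_ringChar (R := F); rw [h] at this; exact_mod_cast this)) hs0]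
      have h1 : s ^ (Q - 1) = 1 := by
        apply mul_right_cancel₀ hs0
        rw [pow_sub_one_mul (by omega), hs, one_mul]
      have h3 : Fintype.card F / 2 = (Q - 1) * H := by
        obtain ⟨R, rfl⟩ : ∃ R, Q = R + 1 := ⟨Q - 1, by omega⟩
        have h : 2 * (R * H) + 1 = (R + 1) ^ 2 := by
          rw [mul_left_comm, ← hH]; ring
        rw [hF, ← h, Nat.add_sub_cancel]; omega
      rw [h3, pow_mul, h1, one_pow]
    obtain ⟨t, rfl⟩ := hsq
    have ht : t ≠ 0 := by rintro rfl; simp at hs0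
    have hid : ∀ x, a * (t * x) ^ 2 + (a * (t * x) ^ 2) ^ Q
        = (t * t) * (a * x ^ 2 + (a * x ^ 2) ^ Q) := fun x => by
      have : a * (t * x) ^ 2 = (t * t) * (a * x ^ 2) := by ring
      rw [this, mul_pow (t * t), hs]; ring
    symm
    refine card_bij (fun x _ => t * x) ?_ ?_ ?_
    · intro x hx
      simp only [mem_filter, mem_univ, true_and] at hx ⊢
      rw [hid, hx, mul_one]
    · intro x _ y _ h
      exact mul_left_cancel₀ ht h
    · intro y hy
      simp only [mem_filter, mem_univ, true_and] at hy
      refine ⟨t⁻¹ * y, ?_, by field_simp⟩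
      simp only [mem_filter, mem_univ, true_and]
      apply mul_left_cancel₀ hs0
      rw [← hid, mul_inv_cancel_left₀ ht, hy, mul_one]
  have htot := card_eq_sum_card_fiberwise (s := (univ : Finset F))
    (t := ({s : F | s ^ Q = s} : Finset F)) (f := fun x => a * x ^ 2 + (a * x ^ 2) ^ Q)
    (fun x _ => by simpa using hmap _)
  have h0 : (0 : F) ∈ ({s : F | s ^ Q = s} : Finset F) := by
    simp [zero_pow (show Q ≠ 0 by omega)]
  rw [← add_sum_erase _ _ h0, sum_congr rfl (g := fun _ =>
      #{x : F | a * x ^ 2 + (a * x ^ 2) ^ Q = 1}) (fun s hs => by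
        simp only [mem_erase, mem_filter, mem_univ, true_and] at hs
        exact key s hs.2 hs.1),
    sum_const, card_erase_of_mem h0, hE, card_univ, hF, smul_eq_mul] at htot
  zify [hQ.le] at htot
  rw [card_sq_add_pow_eq_zero hH hQ hF ha hε hεa h2] at htot
  rw [key s hs hs0]
  have hQ1 : (Q : ℤ) - 1 ≠ 0 := by omega
  apply mul_left_cancel₀ hQ1
  linear_combination -htot

theorem card_powTrace_mul_sq (hp : p.Prime) [CharP F p] (hq : q = p ^ n) (hn : 1 ≤ n)
    {m H : ℕ} (hm : 0 < m) (hF : Fintype.card F = q ^ (2 * m)) (hH : q ^ m + 1 = 2 * H)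
    {a : F} (ha : a ≠ 0) {ε : ℤ} (hε : ε = 1 ∨ ε = -1)
    (hεa : (ε : F) = (-1) ^ H * a ^ ((q ^ m - 1) * H)) (h2 : (2 : F) ≠ 0) {t : F}
    (ht : t ^ q = t) :
    (q : ℤ) * #{x : F | powTrace q (2 * m) (a * x ^ 2) = t} =
      if t = 0 then (q : ℤ) ^ (2 * m) + q ^ m * (q - 1) * ε
      else (q : ℤ) ^ (2 * m) - q ^ m * ε := by
  have := Fact.mk hp
  have hq1 : 1 < q := hq ▸ Nat.one_lt_pow (by omega) hp.one_lt
  have hQ1 : 1 < q ^ m := Nat.one_lt_pow hm.ne' hq1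
  have hF2 : Fintype.card F = (q ^ m) ^ 2 := by rw [hF, ← pow_mul, mul_comm]
  have hE := card_fixed (F := F) (q := q ^ m) (n := n * m) (ℓ := 2) hp (by rw [hq, pow_mul])
    (Nat.mul_pos hn hm) two_pos hF2
  have hmap : ∀ x : F, (x + x ^ q ^ m) ^ q ^ m = x + x ^ q ^ m := fun x => by
    have hx : (x ^ q ^ m) ^ q ^ m = x := by
      rw [← pow_mul, ← sq, ← hF2, FiniteField.pow_card]
    have hadd : ∀ y z : F, (y + z) ^ q ^ m = y ^ q ^ m + z ^ q ^ m := fun y z => by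
      rw [hq, ← pow_mul, add_pow_char_pow]
    rw [hadd, hx, add_comm]
  have hM0 := card_sq_add_pow_eq_zero hH hQ1 hF2 ha hε hεa h2
  have hM := fun s => card_sq_add_pow_eq hH hQ1 hF2 ha hε hεa h2 hE hmap (s := s)
  set S : Finset F := {s : F | s ^ q ^ m = s ∧ powTrace q m s = t} with hS
  have hScard : #S = q ^ (m - 1) := card_powTrace_fiber hp hq hn hm hF ht
  have hfib := card_eq_sum_card_fiberwise
    (s := ({x : F | powTrace q (2 * m) (a * x ^ 2) = t} : Finset F)) (t := S)
    (f := fun x => a * x ^ 2 + (a * x ^ 2) ^ q ^ m) (fun x hx => by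
      have hx' : powTrace q (2 * m) (a * x ^ 2) = t := by simpa using hx
      rw [powTrace_two_mul hp hq] at hx'
      simpa [hS] using ⟨hmap _, hx'⟩)
  have hfib' : #{x : F | powTrace q (2 * m) (a * x ^ 2) = t} =
      ∑ s ∈ S, #{x : F | a * x ^ 2 + (a * x ^ 2) ^ q ^ m = s} := by
    rw [hfib]
    refine sum_congr rfl fun s hs => ?_
    rw [filter_filter]
    congr 1
    ext x
    simp only [mem_filter, mem_univ, true_and, and_iff_right_iff_imp]
    rintro rfl
    rw [powTrace_two_mul hp hq]
    simpa [hS] using (mem_filter.1 hs).2.2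
  have hqm : (q : ℤ) ^ m = q * q ^ (m - 1) := (mul_pow_sub_one hm.ne' _).symm
  have hq2m : (q : ℤ) ^ (2 * m) = q ^ m * q ^ m := by ring
  rw [hfib']
  push_cast
  split_ifs with h0
  · have h0S : (0 : F) ∈ S := by
      have : powTrace q m (0 : F) = 0 := by simpa using powTrace_add hp hq m (0 : F) 0
      simp [hS, h0, this, zero_pow (show q ^ m ≠ 0 by omega)]
    rw [← add_sum_erase _ _ h0S, sum_congr rfl (g := fun _ => ((q ^ m : ℕ) : ℤ) - ε)
      (fun s hs => by
        obtain ⟨hs1, hs2⟩ := mem_erase.1 hs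
        exact hM s (mem_filter.1 hs2).2.1 hs1), hM0, sum_const, card_erase_of_mem h0S, hScard,
      nsmul_eq_mul, Nat.cast_sub (Nat.one_le_pow _ _ (by omega))]
    push_cast
    rw [hq2m, hqm]
    ring
  · rw [sum_congr rfl (g := fun _ => ((q ^ m : ℕ) : ℤ) - ε)
      (fun s hs => hM s (mem_filter.1 hs).2.1 (by
        rintro rfl
        have h1 : powTrace q m (0 : F) = 0 := by simpa using powTrace_add hp hq m (0 : F) 0
        exact h0 (by rw [← (mem_filter.1 hs).2.2, h1]))), sum_const, hScard, nsmul_eq_mul]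
    push_cast
    rw [hq2m, hqm]
    ring

/-- If `gcd(e, |F| - 1) = 2`, then `x ^ e` and `x ^ 2` have the same value distribution. -/
theorem card_filter_pow_eq_card_filter_sq {e : ℕ} (he : e ≠ 0)
    (hgcd : Nat.gcd e (Fintype.card F - 1) = 2) (P : F → Prop) :
    #{x : F | P (x ^ e)} = #{x : F | P (x ^ 2)} := by
  have hF : 1 < Fintype.card F := Fintype.one_lt_card
  obtain ⟨N, hN⟩ : ∃ N, Fintype.card F = N + 1 := ⟨Fintype.card F - 1, by omega⟩
  rw [hN, Nat.add_sub_cancel] at hgcd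
  have hperiod : ∀ (x : F) (k j : ℕ), k ≠ 0 → x ^ (k + N * j) = x ^ k := by
    intro x k j hk
    rcases eq_or_ne x 0 with rfl | hx
    · rw [zero_pow hk, zero_pow (by omega)]
    · have := FiniteField.pow_card_sub_one_eq_one x hx
      rw [hN, Nat.add_sub_cancel] at this
      rw [pow_add, pow_mul, this, one_pow, mul_one]
  obtain ⟨e', rfl⟩ : 2 ∣ e := hgcd ▸ Nat.gcd_dvd_left _ _
  obtain ⟨N', rfl⟩ : 2 ∣ N := hgcd ▸ Nat.gcd_dvd_right _ _
  have hco : Nat.Coprime e' N' := by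
    rw [Nat.gcd_mul_left] at hgcd
    exact Nat.eq_of_mul_eq_mul_left two_pos hgcd
  obtain ⟨f, hf, hfx⟩ : ∃ f, Nat.Coprime f (2 * N') ∧ ∀ x : F, (x ^ f) ^ 2 = x ^ (2 * e') := by
    rcases Nat.even_or_odd e' with hev | hod
    · refine ⟨e' + N', ?_, fun x => ?_⟩
      · have hodd : Odd N' := by
          rw [← Nat.not_even_iff_odd]
          intro hN'
          have := Nat.dvd_gcd hev.two_dvd hN'.two_dvd
          rw [hco] at this
          omega
        refine Nat.Coprime.mul_right ?_ (by simpa using hco)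
        exact (hev.add_odd hodd).coprime_two_right
      · rw [← pow_mul, add_mul, mul_comm e', mul_comm N']
        simpa using hperiod x (2 * e') 1 he
    · exact ⟨e', Nat.Coprime.mul_right hod.coprime_two_right hco, fun x => by
        rw [← pow_mul, mul_comm]⟩
  have hinj : Function.Injective (fun x : F => x ^ f) := by
    have hf0 : 0 < f := Nat.pos_of_ne_zero fun h => by
      rw [h, Nat.coprime_zero_left] at hf; omega
    obtain ⟨g, -, hg⟩ := Nat.exists_mul_mod_eq_of_coprime 1 hf (by omega)
    have hle : 1 ≤ f * (g + 2 * N') := Nat.mul_pos hf0 (by omega)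
    obtain ⟨j, hj⟩ : 2 * N' ∣ f * (g + 2 * N') - 1 := by
      rw [← Nat.modEq_iff_dvd' hle, mul_add]
      exact (show 1 ≡ f * g [MOD 2 * N'] from hg.symm).trans
        (Nat.modEq_iff_dvd' (Nat.le_add_right _ _) |>.2 (by simp))
    have hinv : ∀ x : F, (x ^ f) ^ (g + 2 * N') = x := fun x => by
      rw [← pow_mul, show f * (g + 2 * N') = 1 + 2 * N' * j by omega, hperiod x 1 j one_ne_zero,
        pow_one]
    intro x y h
    simp only at h
    rw [← hinv x, h, hinv]
  have hbij := Finite.injective_iff_bijective.1 hinj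
  refine card_bij (fun x _ => x ^ f) ?_ ?_ ?_
  · intro x hx
    simpa [hfx] using hx
  · intro x _ y _ h
    exact hinj h
  · intro y hy
    obtain ⟨x, rfl⟩ := hbij.2 y
    exact ⟨x, by simpa [hfx] using hy, rfl⟩

theorem natCard_solutions (hp : p.Prime) [CharP F p] (hq : q = p ^ n) (hn : 1 ≤ n)
    {ℓ : ℕ} (hℓ : 0 < ℓ) (hF : Fintype.card F = q ^ ℓ) (h : F → F) :
    Nat.card {xy : F × F // xy.2 ^ q - xy.2 = h xy.1} =
      q * #{x : F | powTrace q ℓ (h x) = 0} := by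
  rw [Nat.card_eq_fintype_card, Fintype.card_subtype,
    card_eq_sum_card_fiberwise (f := Prod.fst) (t := univ) (fun _ _ => by simp)]
  have : ∀ x : F, #{xy ∈ ({xy : F × F | xy.2 ^ q - xy.2 = h xy.1} : Finset (F × F)) | xy.1 = x} =
      if powTrace q ℓ (h x) = 0 then q else 0 := fun x => by
    rw [← card_pow_sub_self_fiber hp hq hn hℓ hF (h x)]
    refine card_bij (fun xy _ => xy.2) ?_ ?_ ?_
    · rintro ⟨x', y⟩ hxy
      simp only [mem_filter, mem_univ, true_and] at hxy ⊢
      rw [hxy.1, hxy.2]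
    · rintro ⟨x', y⟩ hxy ⟨x'', y'⟩ hxy' hy
      simp only [mem_filter, mem_univ, true_and] at hxy hxy' hy
      rw [hxy.2, hxy'.2, hy]
    · intro y hy
      exact ⟨(x, y), by simpa using hy, rfl⟩
  rw [sum_congr rfl fun x _ => this x, ← sum_filter, sum_const, smul_eq_mul, mul_comm]

theorem natCard_solutions_eq (hp : p.Prime) (hp2 : 2 < p) [CharP F p] (hq : q = p ^ n)
    (hn : 1 ≤ n) {m r H : ℕ} (hm : 0 < m) (hF : Fintype.card F = q ^ (2 * m))
    (hodd : Odd (2 * m / Nat.gcd (2 * m) r)) (hH : q ^ m + 1 = 2 * H)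
    {a b c x₀ : F} (ha : a ≠ 0)
    (hx₀ : a ^ q ^ r * x₀ ^ q ^ (2 * r) + a * x₀ = -(b ^ q ^ r)) :
    (Nat.card {xy : F × F // xy.2 ^ q - xy.2 = a * xy.1 ^ (q ^ r + 1) + b * xy.1 + c} : ℤ) =
      if powTrace q (2 * m) (a * x₀ ^ (q ^ r + 1) - c) = 0 then
        (q : ℤ) ^ (2 * m) + q ^ m * (q - 1) * ((-1) ^ H * if IsSquare a then 1 else -1)
      else (q : ℤ) ^ (2 * m) - q ^ m * ((-1) ^ H * if IsSquare a then 1 else -1) := by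
  have hq1 : 1 < q := hq ▸ Nat.one_lt_pow (by omega) hp.one_lt
  have hfr : ∀ x : F, x ^ q ^ (2 * m) = x := fun x => hF ▸ FiniteField.pow_card x
  have hchar : ringChar F = p := ringChar.eq F p
  have hchar2 : ringChar F ≠ 2 := by omega
  have h2 : (2 : F) ≠ 0 := Ring.two_ne_zero hchar2
  have hqodd : Odd q := hq ▸ (hp.odd_of_ne_two (by omega)).pow
  rw [← card_powTrace_mul_sq (ε := (-1) ^ H * if IsSquare a then 1 else -1)
    hp hq hn hm hF hH ha _ _ h2 (pow_powTrace hp hq _ (hfr _)),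
    natCard_solutions hp hq hn (by omega) hF (fun x => a * x ^ (q ^ r + 1) + b * x + c),
    ← card_filter_pow_eq_card_filter_sq (Nat.succ_ne_zero (q ^ r))
      (hF ▸ gcd_pow_add_one_pow_sub_one hqodd (by omega) hodd)
      (fun w => powTrace q (2 * m) (a * w) = powTrace q (2 * m) (a * x₀ ^ (q ^ r + 1) - c))]
  · push_cast
    congr 2
    symm
    refine card_bij (fun z _ => z + x₀) ?_ (fun _ _ _ _ h => add_right_cancel h) ?_
    · intro z hz
      simp only [mem_filter, mem_univ, true_and] at hz ⊢
      rw [powTrace_shift hp hq hfr hx₀, ← hz, sub_self]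
    · intro x hx
      refine ⟨x - x₀, ?_, sub_add_cancel _ _⟩
      simp only [mem_filter, mem_univ, true_and] at hx ⊢
      rw [← sub_add_cancel x x₀, powTrace_shift hp hq hfr hx₀, sub_eq_zero] at hx
      exact hx
  · rcases neg_one_pow_eq_or ℤ H with h | h <;> rw [h] <;> split_ifs <;> simp
  · push_cast
    congr 1
    have h3 : Fintype.card F / 2 = (q ^ m - 1) * H := by
      rw [hF, mul_comm 2 m, pow_mul]
      obtain ⟨R, hR⟩ : ∃ R, q ^ m = R + 1 :=
        ⟨q ^ m - 1, (Nat.sub_add_cancel (Nat.one_le_pow _ _ hq1.le)).symm⟩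
      rw [hR] at hH ⊢
      have h : 2 * (R * H) + 1 = (R + 1) ^ 2 := by
        rw [mul_left_comm, ← hH]; ring
      rw [← h, Nat.add_sub_cancel]; omega
    rw [← h3]
    split_ifs with hsq
    · exact ((FiniteField.isSquare_iff hchar2 ha).1 hsq).symm
    · rcases FiniteField.pow_dichotomy hchar2 ha with h | h
      · exact absurd ((FiniteField.isSquare_iff hchar2 ha).2 h) hsq
      · exact h.symm

end FiniteField

/-- Let `p > 2` be prime, `q = p ^ n`, `ℓ ≥ 2` even and `r ≥ 0` with
`ℓ / u` odd, `u = gcd(ℓ, r)`.  Let `a, b, c ∈ F_{q^ℓ}` with `a ≠ 0`, let `x₀` solve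
`a^(q^r) x^(q^(2r)) + a x = -b^(q^r)` and set `c₁ = a x₀^(q^r+1) - c`.  Then
`N_{ℓ,r}(a,b,c)` is as given in the four cases according to `p mod 4` and whether
`T(c₁) = 0`, `η₁` being the quadratic character of `F_{q^ℓ}`. -/
theorem stmt_7 (p n : ℕ) (hp : p.Prime) (hp2 : 2 < p) (hn : 1 ≤ n)
    (q : ℕ) (hq : q = p ^ n)
    (ℓ r : ℕ) (hℓ : 2 ≤ ℓ) (hle : Even ℓ)
    (u : ℕ) (hu : u = Nat.gcd ℓ r) (hodd : Odd (ℓ / u))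
    (F : Type) [Field F] [Fintype F] (hF : Fintype.card F = q ^ ℓ)
    (T : F → F) (hT : ∀ z : F, T z = ∑ i ∈ Finset.range ℓ, z ^ q ^ i)
    (η : F → ℤ) (hη : ∀ z : F, η z = if z = 0 then 0 else if IsSquare z then 1 else -1)
    (a b c x₀ c₁ : F) (ha : a ≠ 0)
    (hx₀ : a ^ q ^ r * x₀ ^ q ^ (2 * r) + a * x₀ = -(b ^ q ^ r))
    (hc₁ : c₁ = a * x₀ ^ (q ^ r + 1) - c) :
    (p % 4 = 1 → T c₁ = 0 →
      (Nat.card {xy : F × F //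
          xy.2 ^ q - xy.2 = a * xy.1 ^ (q ^ r + 1) + b * xy.1 + c} : ℤ)
        = (q : ℤ) ^ ℓ - (q : ℤ) ^ (ℓ / 2) * ((q : ℤ) - 1) * η a) ∧
    (p % 4 = 1 → T c₁ ≠ 0 →
      (Nat.card {xy : F × F //
          xy.2 ^ q - xy.2 = a * xy.1 ^ (q ^ r + 1) + b * xy.1 + c} : ℤ)
        = (q : ℤ) ^ ℓ + (q : ℤ) ^ (ℓ / 2) * η a) ∧
    (p % 4 = 3 → T c₁ = 0 →
      (Nat.card {xy : F × F //
          xy.2 ^ q - xy.2 = a * xy.1 ^ (q ^ r + 1) + b * xy.1 + c} : ℤ)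
        = (q : ℤ) ^ ℓ
            + (-1 : ℤ) ^ (1 + n * (ℓ / 2)) * (q : ℤ) ^ (ℓ / 2) * ((q : ℤ) - 1) * η a) ∧
    (p % 4 = 3 → T c₁ ≠ 0 →
      (Nat.card {xy : F × F //
          xy.2 ^ q - xy.2 = a * xy.1 ^ (q ^ r + 1) + b * xy.1 + c} : ℤ)
        = (q : ℤ) ^ ℓ + (-1 : ℤ) ^ (n * (ℓ / 2)) * (q : ℤ) ^ (ℓ / 2) * η a) := by
  have := Fact.mk hp
  obtain ⟨m, rfl⟩ := hle.two_dvd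
  have hm : 0 < m := by omega
  have : CharP F p := charP_of_card_eq_prime_pow (f := n * (2 * m)) (by
    rw [hF, hq, ← pow_mul])
  have hpodd : Odd p := hp.odd_of_ne_two (by omega)
  have hqm : q ^ m = p ^ (n * m) := by rw [hq, pow_mul]
  obtain ⟨H, hH⟩ : 2 ∣ q ^ m + 1 := hqm ▸ (hpodd.pow.add_odd odd_one).two_dvd
  have key := natCard_solutions_eq (c := c) hp hp2 hq hn hm hF (hu ▸ hodd) hH ha hx₀
  have hTc : T c₁ = powTrace q (2 * m) (a * x₀ ^ (q ^ r + 1) - c) := by rw [hT, hc₁]; rfl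
  rw [key, hTc, hη, if_neg ha, Nat.mul_div_cancel_left m two_pos]
  have hone : p % 4 = 1 → (-1 : ℤ) ^ H = -1 := fun h => by
    refine Odd.neg_one_pow (Nat.odd_iff.2 ?_)
    have : p ^ (n * m) % 4 = 1 := by rw [Nat.pow_mod, h]; simp
    omega
  have hthree := fun h : p % 4 = 3 => neg_one_pow_of_mod_four_eq_three h (hqm ▸ hH)
  refine ⟨fun h h0 => ?_, fun h h0 => ?_, fun h h0 => ?_, fun h h0 => ?_⟩
  · rw [if_pos h0, hone h]; ring
  · rw [if_neg h0, hone h]; ring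
  · rw [if_pos h0, hthree h]; ring
  · rw [if_neg h0, hthree h]; ring
end

section
/- Let p be a prime, q = p^n, and let ℓ ≥ 2 and r ≥ 1 be integers such that ℓ/u is even, where u = gcd(ℓ, r). Let a, b, c ∈ F_{q^ℓ} with a ≠ 0 and set f(x) = a^{q^r}·x^{q^{2r}} + a·x. Suppose the map x ↦ f(x) is a bijection of F_{q^ℓ} (i.e., f is a permutation polynomial over F_{q^ℓ}), let x₀ ∈ F_{q^ℓ} be the solution of f(x) = −b^{q^r}, and set c₁ = a·x₀^{q^r+1} − c. Then N_{ℓ,r}(a,b,c) = q^ℓ + (−1)^{ℓ/(2u)}·q^{ℓ/2}·(q−1) if T(c₁) = 0, and N_{ℓ,r}(a,b,c) = q^ℓ + (−1)^{ℓ/(2u)+1}·q^{ℓ/2} if T(c₁) ≠ 0. -/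
open Finset

section FiberCount

variable {α β : Type*} [DecidableEq β] {s : Finset α} {t : Finset β} {f : α → β} {k m : ℕ}

/-- If the fibers of `f : s → t` have at most `m` elements, `t` has at most `k` elements and
`s` has exactly `k * m` elements, then every fiber has exactly `m` elements. -/
lemma card_fiber_eq_of_le_s9 (hf : ∀ a ∈ s, f a ∈ t) (hfib : ∀ b ∈ t, #{a ∈ s | f a = b} ≤ m)
    (ht : #t ≤ k) (hs : #s = k * m) : ∀ b ∈ t, #{a ∈ s | f a = b} = m := by
  have hsum := card_eq_sum_card_fiberwise hf
  refine (sum_eq_sum_iff_of_le hfib).mp (le_antisymm (sum_le_sum hfib) ?_)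
  rw [← hsum, sum_const, smul_eq_mul, hs]
  gcongr

/-- In the situation of `card_fiber_eq_of_le` the target has exactly `k` elements. -/
lemma card_target_eq_of_le (hf : ∀ a ∈ s, f a ∈ t) (hfib : ∀ b ∈ t, #{a ∈ s | f a = b} ≤ m)
    (ht : #t ≤ k) (hs : #s = k * m) (hm : 0 < m) : #t = k := by
  have hsum := card_eq_sum_card_fiberwise hf
  rw [sum_congr rfl (card_fiber_eq_of_le_s9 hf hfib ht hs), sum_const, smul_eq_mul, hs] at hsum
  exact (Nat.eq_of_mul_eq_mul_right hm hsum).symm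

end FiberCount

section FiniteField

variable {F : Type*} [Field F]

lemma card_filter_pow_eq_le [Fintype F] [DecidableEq F] {e : ℕ} (he : 0 < e) (v : F) :
    #{x : F | x ^ e = v} ≤ e := by
  refine le_trans ?_ (Polynomial.card_nthRoots e v)
  refine Multiset.card_le_card ((Multiset.le_iff_subset (nodup _)).mpr fun x hx => ?_)
  rw [Polynomial.mem_nthRoots he]
  simpa using hx

/-- If `k * e` is the order of the unit group, each `k`-th root of unity has `e` distinct
`e`-th roots. -/
lemma card_filter_pow_eq [Fintype F] [DecidableEq F] {k e : ℕ} (hk : 0 < k) (he : 0 < e)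
    (hcard : Fintype.card F - 1 = k * e)
    {v : F} (hv : v ^ k = 1) : #{x : F | x ^ e = v} = e := by
  have hv0 : v ≠ 0 := by rintro rfl; simp [hk.ne'] at hv
  have key := card_fiber_eq_of_le_s9 (s := {x : F | x ≠ 0}) (t := {v : F | v ^ k = 1})
    (f := fun x => x ^ e) (k := k) (m := e) (fun x hx => by
      simp only [mem_filter, mem_univ, true_and] at hx ⊢
      rw [← pow_mul, mul_comm, ← hcard, FiniteField.pow_card_sub_one_eq_one x hx])
    (fun v _ => (card_le_card (filter_subset_filter _ (subset_univ _))).trans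
      (card_filter_pow_eq_le he v))
    (card_filter_pow_eq_le hk 1)
    (by rw [← hcard, filter_ne' , card_erase_of_mem (mem_univ _), card_univ])
    v (by simpa using hv)
  refine Eq.trans ?_ key
  rw [filter_filter]
  congr 1
  ext x
  simp only [mem_filter, mem_univ, true_and, iff_and_self]
  rintro rfl rfl
  simp [he.ne'] at hv0

/-- A set of nonzero elements that is a union of fibers of `x ↦ x ^ e` has cardinality
divisible by `e`. -/
lemma dvd_card_filter_of_pow [Fintype F] [DecidableEq F] {k e : ℕ} (hk : 0 < k) (he : 0 < e)
    (hcard : Fintype.card F - 1 = k * e) (P : F → Prop) [DecidablePred P]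
    (hP0 : ¬ P 0) (hP : ∀ x y, x ^ e = y ^ e → P x → P y) : e ∣ #{x : F | P x} := by
  rw [card_eq_sum_card_fiberwise (f := fun x => x ^ e) (t := univ)
    (fun _ _ => mem_coe.mpr (mem_univ _))]
  refine dvd_sum fun v _ => ?_
  by_cases h : ∃ x, P x ∧ x ^ e = v
  · obtain ⟨x, hx, rfl⟩ := h
    have hx0 : x ≠ 0 := by rintro rfl; exact hP0 hx
    have hv : (x ^ e) ^ k = 1 := by
      rw [← pow_mul, mul_comm, ← hcard, FiniteField.pow_card_sub_one_eq_one x hx0]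
    have : #{y ∈ ({x : F | P x} : Finset F) | y ^ e = x ^ e} = #{y : F | y ^ e = x ^ e} := by
      rw [filter_filter]
      congr 1
      ext y
      simp only [mem_filter, mem_univ, true_and, and_iff_right_iff_imp]
      exact fun hy => hP x y hy.symm hx
    rw [this, card_filter_pow_eq hk he hcard hv]
  · have : ({y ∈ ({x : F | P x} : Finset F) | y ^ e = v}) = ∅ := by
      ext y
      simp only [mem_filter, mem_univ, true_and, notMem_empty, iff_false]
      exact fun hy => h ⟨y, hy⟩
    simp [this]

/-- The sum of the first `ℓ` iterates of the `q`-power map; on `𝔽_{q^ℓ}` this is the trace to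
`𝔽_q`. -/
def frobTrace (q ℓ : ℕ) (z : F) : F := ∑ i ∈ range ℓ, z ^ q ^ i

variable {q ℓ : ℕ}

lemma add_pow_pow (hadd : ∀ x y : F, (x + y) ^ q = x ^ q + y ^ q) (i : ℕ) (x y : F) :
    (x + y) ^ q ^ i = x ^ q ^ i + y ^ q ^ i := by
  induction i with
  | zero => simp
  | succ i ih => rw [pow_succ, pow_mul, ih, hadd, ← pow_mul, ← pow_mul]

lemma frobTrace_add (hadd : ∀ x y : F, (x + y) ^ q = x ^ q + y ^ q) (x y : F) :
    frobTrace q ℓ (x + y) = frobTrace q ℓ x + frobTrace q ℓ y := by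
  simp only [frobTrace, add_pow_pow hadd, sum_add_distrib]

lemma frobTrace_pow_eq_sum (hq : 0 < q) (hadd : ∀ x y : F, (x + y) ^ q = x ^ q + y ^ q) (x : F) :
    frobTrace q ℓ x ^ q = frobTrace q ℓ (x ^ q) := by
  unfold frobTrace
  induction ℓ with
  | zero => simp [hq.ne']
  | succ ℓ ih =>
    rw [sum_range_succ, sum_range_succ, hadd, ih, ← pow_mul, ← pow_mul, mul_comm]

lemma frobTrace_pow [Fintype F] (hcard : Fintype.card F = q ^ ℓ) (x : F) :
    frobTrace q ℓ (x ^ q) = frobTrace q ℓ x := by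
  unfold frobTrace
  have h := (sum_range_succ (fun i => x ^ q ^ i) ℓ).symm.trans
    (sum_range_succ' (fun i => x ^ q ^ i) ℓ)
  rw [← hcard, FiniteField.pow_card] at h
  simp only [pow_zero, pow_one] at h
  rw [add_right_cancel h]
  exact sum_congr rfl fun i _ => by rw [← pow_mul, pow_succ, mul_comm]

lemma frobTrace_pow_pow [Fintype F] (hcard : Fintype.card F = q ^ ℓ) (i : ℕ) (x : F) :
    frobTrace q ℓ (x ^ q ^ i) = frobTrace q ℓ x := by
  induction i with
  | zero => simp
  | succ i ih => rw [pow_succ, pow_mul, frobTrace_pow hcard, ih]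

lemma frobTrace_mul {s : F} (hs : s ^ q = s) (x : F) :
    frobTrace q ℓ (s * x) = s * frobTrace q ℓ x := by
  have h : ∀ i, s ^ q ^ i = s := by
    intro i
    induction i with
    | zero => simp
    | succ i ih => rw [pow_succ, pow_mul, ih, hs]
  simp only [frobTrace, mul_pow, h, mul_sum]

lemma card_filter_frobTrace_eq_le [Fintype F] [DecidableEq F] (hq : 2 ≤ q) (hℓ : 1 ≤ ℓ) (s : F) :
    #{x : F | frobTrace q ℓ x = s} ≤ q ^ (ℓ - 1) := by
  obtain ⟨ℓ, rfl⟩ := Nat.exists_eq_add_of_le' hℓ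
  simp only [Nat.add_sub_cancel]
  have hlt : (∑ i ∈ range ℓ, (Polynomial.X : Polynomial F) ^ q ^ i).degree < ↑(q ^ ℓ) := by
    refine (Polynomial.degree_sum_le _ _).trans_lt ?_
    rw [Finset.sup_lt_iff (WithBot.bot_lt_coe _)]
    intro i hi
    rw [Polynomial.degree_X_pow]
    exact_mod_cast Nat.pow_lt_pow_right hq (mem_range.mp hi)
  have hpos : 0 < q ^ ℓ := by positivity
  have hlt2 : (∑ i ∈ range ℓ, (Polynomial.X : Polynomial F) ^ q ^ i - Polynomial.C s).degree
      < ↑(q ^ ℓ) := by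
    refine (Polynomial.degree_sub_le _ _).trans_lt (max_lt hlt ?_)
    refine Polynomial.degree_C_le.trans_lt ?_
    exact_mod_cast hpos
  set P : Polynomial F := Polynomial.X ^ q ^ ℓ +
    (∑ i ∈ range ℓ, (Polynomial.X : Polynomial F) ^ q ^ i - Polynomial.C s) with hP
  have hdeg : P.degree = ↑(q ^ ℓ) := by
    rw [hP, Polynomial.degree_add_eq_left_of_degree_lt, Polynomial.degree_X_pow]
    rwa [Polynomial.degree_X_pow]
  have hP0 : P ≠ 0 := by
    rintro h0
    rw [h0, Polynomial.degree_zero] at hdeg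
    exact absurd hdeg (WithBot.bot_ne_coe)
  rw [← Polynomial.natDegree_eq_of_degree_eq_some hdeg]
  refine Polynomial.card_le_degree_of_subset_roots fun x hx => ?_
  rw [Polynomial.mem_roots hP0]
  have hx : frobTrace q (ℓ + 1) x = s := by simpa using hx
  simp only [hP, Polynomial.IsRoot.def, Polynomial.eval_add, Polynomial.eval_sub,
    Polynomial.eval_pow, Polynomial.eval_X, Polynomial.eval_C, Polynomial.eval_finsetSum]
  rw [← hx, frobTrace, sum_range_succ]
  ring

lemma card_filter_pow_sub_le [Fintype F] [DecidableEq F] (hq : 2 ≤ q) (z : F) :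
    #{y : F | y ^ q - y = z} ≤ q := by
  have hlt : (Polynomial.X + Polynomial.C z : Polynomial F).degree < ↑q := by
    rw [Polynomial.degree_X_add_C]
    exact_mod_cast hq
  have hdeg : (Polynomial.X ^ q - (Polynomial.X + Polynomial.C z) : Polynomial F).degree = ↑q := by
    rw [Polynomial.degree_sub_eq_left_of_degree_lt, Polynomial.degree_X_pow]
    rwa [Polynomial.degree_X_pow]
  have hP0 : (Polynomial.X ^ q - (Polynomial.X + Polynomial.C z) : Polynomial F) ≠ 0 := by
    rintro h0
    rw [h0, Polynomial.degree_zero] at hdeg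
    exact absurd hdeg (WithBot.bot_ne_coe)
  refine le_trans ?_ (Polynomial.natDegree_eq_of_degree_eq_some hdeg).le
  refine Polynomial.card_le_degree_of_subset_roots fun y hy => ?_
  rw [Polynomial.mem_roots hP0]
  have hy : y ^ q - y = z := by simpa using hy
  simp [← hy]

lemma card_filter_pow_eq_self_le [Fintype F] [DecidableEq F] (hq : 2 ≤ q) :
    #{s : F | s ^ q = s} ≤ q := by
  simpa only [sub_eq_zero] using card_filter_pow_sub_le hq (0 : F)

lemma frobTrace_pow_self [Fintype F] (hq : 2 ≤ q) (hadd : ∀ x y : F, (x + y) ^ q = x ^ q + y ^ q)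
    (hcard : Fintype.card F = q ^ ℓ) (x : F) :
    frobTrace q ℓ x ^ q = frobTrace q ℓ x := by
  rw [frobTrace_pow_eq_sum (by omega) hadd, frobTrace_pow hcard]

lemma card_filter_frobTrace_eq [Fintype F] [DecidableEq F] (hq : 2 ≤ q) (hℓ : 1 ≤ ℓ)
    (hadd : ∀ x y : F, (x + y) ^ q = x ^ q + y ^ q) (hcard : Fintype.card F = q ^ ℓ)
    {s : F} (hs : s ^ q = s) : #{x : F | frobTrace q ℓ x = s} = q ^ (ℓ - 1) :=
  card_fiber_eq_of_le_s9 (s := univ) (t := {s : F | s ^ q = s}) (f := frobTrace q ℓ)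
    (fun x _ => by simpa using frobTrace_pow_self hq hadd hcard x)
    (fun s _ => card_filter_frobTrace_eq_le hq hℓ s) (card_filter_pow_eq_self_le hq)
    (by rw [card_univ, hcard, mul_pow_sub_one (by omega)]) s (by simpa using hs)

lemma card_filter_pow_eq_self [Fintype F] [DecidableEq F] (hq : 2 ≤ q) (hℓ : 1 ≤ ℓ)
    (hadd : ∀ x y : F, (x + y) ^ q = x ^ q + y ^ q) (hcard : Fintype.card F = q ^ ℓ) :
    #{s : F | s ^ q = s} = q :=
  card_target_eq_of_le (s := univ) (t := {s : F | s ^ q = s}) (f := frobTrace q ℓ)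
    (fun x _ => by simpa using frobTrace_pow_self hq hadd hcard x)
    (fun s _ => card_filter_frobTrace_eq_le hq hℓ s) (card_filter_pow_eq_self_le hq)
    (by rw [card_univ, hcard, mul_pow_sub_one (by omega)]) (by positivity)

lemma frobTrace_pow_sub [Fintype F] (hadd : ∀ x y : F, (x + y) ^ q = x ^ q + y ^ q)
    (hcard : Fintype.card F = q ^ ℓ) (y : F) : frobTrace q ℓ (y ^ q - y) = 0 := by
  have h := frobTrace_add (ℓ := ℓ) hadd (y ^ q - y) y
  rw [sub_add_cancel, frobTrace_pow hcard] at h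
  simpa using h

/-- Additive Hilbert 90, in counting form. -/
lemma card_filter_pow_sub_eq [Fintype F] [DecidableEq F] (hq : 2 ≤ q) (hℓ : 1 ≤ ℓ)
    (hadd : ∀ x y : F, (x + y) ^ q = x ^ q + y ^ q) (hcard : Fintype.card F = q ^ ℓ) (z : F) :
    #{y : F | y ^ q - y = z} = if frobTrace q ℓ z = 0 then q else 0 := by
  split_ifs with hz
  · exact card_fiber_eq_of_le_s9 (s := univ) (t := {z : F | frobTrace q ℓ z = 0})
      (f := fun y => y ^ q - y) (fun y _ => by simpa using frobTrace_pow_sub hadd hcard y)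
      (fun z _ => card_filter_pow_sub_le hq z) (card_filter_frobTrace_eq_le hq hℓ 0)
      (by rw [card_univ, hcard, pow_sub_one_mul (by omega)]) z (by simpa using hz)
  · rw [card_eq_zero, filter_eq_empty_iff]
    rintro y - rfl
    exact hz (frobTrace_pow_sub hadd hcard y)

section QuadraticForm

variable {a : F} {r : ℕ}

/-- The polar form of `x ↦ Tr (a * x ^ (q ^ r + 1))`. -/
lemma frobTrace_quad_add [Fintype F] (hadd : ∀ x y : F, (x + y) ^ q = x ^ q + y ^ q)
    (hcard : Fintype.card F = q ^ ℓ) (y z : F) :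
    frobTrace q ℓ (a * (y + z) ^ (q ^ r + 1)) =
      frobTrace q ℓ (a * y ^ (q ^ r + 1)) + frobTrace q ℓ (a * z ^ (q ^ r + 1)) +
        frobTrace q ℓ (y ^ q ^ r * (a ^ q ^ r * z ^ q ^ (2 * r) + a * z)) := by
  have h1 : a * (y + z) ^ (q ^ r + 1) = a * y ^ (q ^ r + 1) + a * z ^ (q ^ r + 1) +
      (a * y * z ^ q ^ r + y ^ q ^ r * (a * z)) := by
    rw [pow_succ, add_pow_pow hadd]; ring
  have h2 : (a * y * z ^ q ^ r) ^ q ^ r = y ^ q ^ r * (a ^ q ^ r * z ^ q ^ (2 * r)) := by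
    rw [mul_pow, mul_pow, ← pow_mul z, two_mul, pow_add q]; ring
  rw [h1, frobTrace_add hadd, frobTrace_add hadd, frobTrace_add hadd,
    ← frobTrace_pow_pow hcard r (a * y * z ^ q ^ r), h2, mul_add, frobTrace_add hadd]

/-- Translating by a nonzero vector preserves a nondegenerate form on an affine hyperplane. -/
lemma card_filter_quad_add_eq [Fintype F] [DecidableEq F] (hq : 2 ≤ q) (hℓ : 1 ≤ ℓ)
    (hadd : ∀ x y : F, (x + y) ^ q = x ^ q + y ^ q) (hcard : Fintype.card F = q ^ ℓ)
    {z : F} (hz : a ^ q ^ r * z ^ q ^ (2 * r) + a * z ≠ 0) :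
    #{y : F | frobTrace q ℓ (a * (y + z) ^ (q ^ r + 1)) = frobTrace q ℓ (a * y ^ (q ^ r + 1))} =
      q ^ (ℓ - 1) := by
  have hinj : Function.Injective fun y : F => y ^ q ^ r := by
    intro x y hxy
    have h := add_pow_pow hadd r (x - y) y
    rw [sub_add_cancel] at h
    simp only at hxy
    rw [hxy] at h
    have h' : (x - y) ^ q ^ r = 0 := by simpa using h.symm
    exact sub_eq_zero.mp (eq_zero_of_pow_eq_zero h')
  have hbij : Function.Bijective
      fun y : F => y ^ q ^ r * (a ^ q ^ r * z ^ q ^ (2 * r) + a * z) :=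
    Finite.injective_iff_bijective.mp fun x y hxy => hinj (mul_right_cancel₀ hz hxy)
  set Qz := frobTrace q ℓ (a * z ^ (q ^ r + 1)) with hQz
  have hneg : (-Qz) ^ q = -Qz := by
    have h := hadd Qz (-Qz)
    rw [add_neg_cancel, zero_pow (by omega), frobTrace_pow_self hq hadd hcard] at h
    linear_combination -h
  rw [← card_filter_frobTrace_eq hq hℓ hadd hcard hneg]
  refine card_bijective _ hbij fun y => ?_
  simp only [mem_filter, mem_univ, true_and]
  rw [frobTrace_quad_add hadd hcard, ← hQz]
  constructor <;> intro h <;> linear_combination h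

/-- The second moment of the fiber sizes of a nondegenerate form. -/
lemma sum_card_filter_quad_eq [Fintype F] [DecidableEq F] (hq : 2 ≤ q) (hℓ : 1 ≤ ℓ)
    (hadd : ∀ x y : F, (x + y) ^ q = x ^ q + y ^ q) (hcard : Fintype.card F = q ^ ℓ)
    (hker : ∀ z : F, z ≠ 0 → a ^ q ^ r * z ^ q ^ (2 * r) + a * z ≠ 0) :
    ∑ y : F, #{x : F | frobTrace q ℓ (a * x ^ (q ^ r + 1)) = frobTrace q ℓ (a * y ^ (q ^ r + 1))} =
      q ^ ℓ + (q ^ ℓ - 1) * q ^ (ℓ - 1) := by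
  have h1 : ∀ y : F,
      #{x : F | frobTrace q ℓ (a * x ^ (q ^ r + 1)) = frobTrace q ℓ (a * y ^ (q ^ r + 1))} =
      ∑ z : F, if frobTrace q ℓ (a * (y + z) ^ (q ^ r + 1)) =
        frobTrace q ℓ (a * y ^ (q ^ r + 1)) then 1 else 0 := fun y => by
    rw [card_filter]
    exact (Fintype.sum_equiv (Equiv.addLeft y) _ _ fun z => rfl).symm
  rw [sum_congr rfl fun y _ => h1 y, sum_comm, ← add_sum_erase _ _ (mem_univ (0 : F))]
  congr 1
  · simp [hcard]
  · rw [← hcard, ← card_univ, ← card_erase_of_mem (mem_univ (0 : F)), ← smul_eq_mul, ← sum_const]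
    refine sum_congr rfl fun z hz => ?_
    rw [← card_filter, card_filter_quad_add_eq hq hℓ hadd hcard (hker z (ne_of_mem_erase hz))]

/-- If all nonzero values are taken equally often, the two fiber sizes of a nondegenerate form
satisfy a linear and a quadratic relation. -/
lemma card_filter_quad_relations [Fintype F] [DecidableEq F] (hq : 2 ≤ q) (hℓ : 1 ≤ ℓ)
    (hadd : ∀ x y : F, (x + y) ^ q = x ^ q + y ^ q) (hcard : Fintype.card F = q ^ ℓ)
    (hker : ∀ z : F, z ≠ 0 → a ^ q ^ r * z ^ q ^ (2 * r) + a * z ≠ 0) {N₀ N₁ : ℕ}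
    (h₀ : #{x : F | frobTrace q ℓ (a * x ^ (q ^ r + 1)) = 0} = N₀)
    (h₁ : ∀ s : F, s ^ q = s → s ≠ 0 →
      #{x : F | frobTrace q ℓ (a * x ^ (q ^ r + 1)) = s} = N₁) :
    N₀ + (q - 1) * N₁ = q ^ ℓ ∧
      N₀ * N₀ + (q - 1) * (N₁ * N₁) = q ^ ℓ + (q ^ ℓ - 1) * q ^ (ℓ - 1) := by
  have hmaps : ∀ x ∈ (univ : Finset F),
      frobTrace q ℓ (a * x ^ (q ^ r + 1)) ∈ ({s : F | s ^ q = s} : Finset F) := fun x _ => by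
    simpa using frobTrace_pow_self hq hadd hcard _
  have h0mem : (0 : F) ∈ ({s : F | s ^ q = s} : Finset F) := by
    simp [show q ≠ 0 by omega]
  have hK : #(({s : F | s ^ q = s} : Finset F).erase 0) = q - 1 := by
    rw [card_erase_of_mem h0mem, card_filter_pow_eq_self hq hℓ hadd hcard]
  have h₁' : ∀ s ∈ ({s : F | s ^ q = s} : Finset F).erase 0,
      #{x : F | frobTrace q ℓ (a * x ^ (q ^ r + 1)) = s} = N₁ := fun s hs =>
    h₁ s (by simpa using mem_of_mem_erase hs) (ne_of_mem_erase hs)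
  constructor
  · rw [← hcard, ← card_univ, card_eq_sum_card_fiberwise hmaps, ← add_sum_erase _ _ h0mem, h₀,
      sum_congr rfl h₁', sum_const, hK, smul_eq_mul]
  · rw [← sum_card_filter_quad_eq hq hℓ hadd hcard hker, ← sum_fiberwise_of_maps_to hmaps]
    have h2 : ∀ s : F, ∑ y ∈ {y : F | frobTrace q ℓ (a * y ^ (q ^ r + 1)) = s},
        #{x : F | frobTrace q ℓ (a * x ^ (q ^ r + 1)) = frobTrace q ℓ (a * y ^ (q ^ r + 1))} =
        #{x : F | frobTrace q ℓ (a * x ^ (q ^ r + 1)) = s} *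
          #{x : F | frobTrace q ℓ (a * x ^ (q ^ r + 1)) = s} := fun s => by
      rw [← smul_eq_mul, ← sum_const]
      refine sum_congr rfl fun y hy => ?_
      rw [(mem_filter.mp hy).2]
    rw [sum_congr rfl fun s _ => h2 s, ← add_sum_erase _ _ h0mem, h₀,
      sum_congr rfl fun s hs => by rw [h₁' s hs], sum_const, hK, smul_eq_mul]

end QuadraticForm

section EvenQuotient

lemma exists_pow_sub_one_eq (q u k : ℕ) :
    ∃ g, q ^ (2 * u * k) - 1 = (q ^ u - 1) * g * (q ^ u + 1) := by
  have h1 : q ^ (2 * u) - 1 = (q ^ u + 1) * (q ^ u - 1) := by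
    rw [mul_comm 2, pow_mul, ← Nat.sq_sub_sq, one_pow]
  have h2 : q ^ (2 * u) - 1 ∣ q ^ (2 * u * k) - 1 := by
    simpa [pow_mul] using Nat.sub_dvd_pow_sub_pow (q ^ (2 * u)) 1 k
  obtain ⟨g, hg⟩ := h2
  exact ⟨g, by rw [hg, h1]; ring⟩

variable {a : F} {u k i : ℕ}

/-- Every nonzero element of the fixed field of `x ↦ x ^ q` is a `(q ^ r + 1)`-th power when
`r` is an odd multiple of `u` and `2 * u` divides the degree. -/
lemma exists_pow_add_one_eq [Fintype F] (hq : 2 ≤ q) (hu : 1 ≤ u) (hk : 1 ≤ k)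
    (hcard : Fintype.card F = q ^ (2 * u * k)) {s : F} (hs : s ^ q = s) (hs0 : s ≠ 0) :
    ∃ w : F, w ^ (q ^ (u * (2 * i + 1)) + 1) = s := by
  classical
  obtain ⟨g, hg⟩ := exists_pow_sub_one_eq q u k
  have hqu : 1 < q ^ u := Nat.one_lt_pow (by omega) (by omega)
  have hpos : 0 < q ^ (2 * u * k) - 1 :=
    Nat.sub_pos_of_lt (Nat.one_lt_pow (by positivity) (by omega))
  have hsu : s ^ q ^ u = s := by
    clear hu hcard hg hqu hpos
    induction u with
    | zero => simp
    | succ u ih => rw [pow_succ, pow_mul, ih, hs]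
  have hsu1 : s ^ (q ^ u - 1) = 1 := by
    refine mul_right_cancel₀ hs0 ?_
    rw [pow_sub_one_mul (by positivity), hsu, one_mul]
  have hkpos : 0 < (q ^ u - 1) * g := by
    rw [hg] at hpos
    exact Nat.pos_of_mul_pos_right hpos
  have hroots := card_filter_pow_eq hkpos (e := q ^ u + 1) (by omega) (by rw [hcard, hg])
    (v := s) (by rw [pow_mul, hsu1, one_pow])
  obtain ⟨w, hw⟩ := card_pos.mp (hroots.ge.trans_lt' (Nat.succ_pos _))
  have hw : w ^ (q ^ u + 1) = s := by simpa using hw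
  have hw2 : w ^ q ^ (2 * u) = w := by
    have h : q ^ (2 * u) = (q ^ u + 1) * (q ^ u - 1) + 1 := by
      rw [mul_comm 2, pow_mul, ← Nat.sq_sub_sq, one_pow, Nat.sub_add_cancel]
      exact Nat.one_le_pow _ _ (by omega)
    rw [h, pow_succ, pow_mul, hw, hsu1, one_mul]
  have hw3 : ∀ i, w ^ q ^ (2 * u * i) = w := by
    intro i
    induction i with
    | zero => simp
    | succ i ih => rw [mul_add, mul_one, pow_add, pow_mul, ih, hw2]
  refine ⟨w, ?_⟩
  rw [show u * (2 * i + 1) = 2 * u * i + u by ring, pow_succ w, pow_add, pow_mul, hw3,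
    ← pow_succ, hw]

lemma card_filter_quad_eq_one [Fintype F] [DecidableEq F] (hq : 2 ≤ q) (hu : 1 ≤ u) (hk : 1 ≤ k)
    (hcard : Fintype.card F = q ^ (2 * u * k)) {s : F} (hs : s ^ q = s) (hs0 : s ≠ 0) :
    #{x : F | frobTrace q ℓ (a * x ^ (q ^ (u * (2 * i + 1)) + 1)) = s} =
      #{x : F | frobTrace q ℓ (a * x ^ (q ^ (u * (2 * i + 1)) + 1)) = 1} := by
  obtain ⟨w, hw⟩ := exists_pow_add_one_eq (i := i) hq hu hk hcard hs hs0
  have hw0 : w ≠ 0 := by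
    rintro rfl
    simp only [zero_pow (Nat.succ_ne_zero _)] at hw
    exact hs0 hw.symm
  refine (card_bijective _ (mulLeft_bijective₀ w hw0) fun x => ?_).symm
  simp only [mem_filter, mem_univ, true_and]
  rw [mul_pow, hw, mul_left_comm, frobTrace_mul hs]
  constructor
  · intro h; rw [h, mul_one]
  · intro h; exact mul_left_cancel₀ hs0 (h.trans (mul_one s).symm)

lemma dvd_card_filter_quad [Fintype F] [DecidableEq F] (hq : 2 ≤ q) (hu : 1 ≤ u) (hk : 1 ≤ k)
    (hcard : Fintype.card F = q ^ (2 * u * k)) :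
    q ^ u + 1 ∣ #{x : F | frobTrace q ℓ (a * x ^ (q ^ (u * (2 * i + 1)) + 1)) = 1} := by
  obtain ⟨g, hg⟩ := exists_pow_sub_one_eq q u k
  have hpos : 0 < q ^ (2 * u * k) - 1 :=
    Nat.sub_pos_of_lt (Nat.one_lt_pow (by positivity) (by omega))
  have hkpos : 0 < (q ^ u - 1) * g := by
    rw [hg] at hpos
    exact Nat.pos_of_mul_pos_right hpos
  have hdvd : q ^ u + 1 ∣ q ^ (u * (2 * i + 1)) + 1 := by
    simpa [pow_mul] using Odd.nat_add_dvd_pow_add_pow (q ^ u) 1 (n := 2 * i + 1) ⟨i, rfl⟩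
  obtain ⟨f, hf⟩ := hdvd
  refine dvd_card_filter_of_pow hkpos (Nat.succ_pos _) (by rw [hcard, hg]) _ ?_ ?_
  · have h : frobTrace q ℓ (0 : F) = 0 := by
      have := frobTrace_mul (q := q) (ℓ := ℓ) (s := (0 : F)) (zero_pow (by omega)) 0
      simpa using this
    simp [h]
  · intro x y hxy hx
    rw [hf, pow_mul] at hx ⊢
    rwa [← hxy]

/-- The arithmetic that extracts the fiber sizes from the two moments; the sign is forced by
divisibility. -/
lemma mul_eq_of_moments {q Q H e ε N₀ N₁ : ℤ} (hq : 2 ≤ q) (he : 3 ≤ e)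
    (hH : q * Q = H * H) (hε : ε * ε = 1) (hHe : e ∣ H - ε) (hN : e ∣ N₁)
    (h₁ : N₀ + (q - 1) * N₁ = q * Q)
    (h₂ : N₀ * N₀ + (q - 1) * (N₁ * N₁) = q * Q + (q * Q - 1) * Q) :
    q * N₁ = H * H - ε * H := by
  have hN₀ : N₀ = q * Q - (q - 1) * N₁ := by linarith
  subst hN₀
  have hd : q * ((N₁ - Q) * (N₁ - Q)) = Q := by
    refine mul_left_cancel₀ (show q - 1 ≠ 0 by omega) ?_
    linear_combination h₂
  have hsq : (q * N₁ - H * H) ^ 2 = (ε * H) ^ 2 := by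
    linear_combination q * hd + (ε * ε) * hH - (q * Q) * hε +
      (2 * q * N₁ - q * Q - H * H) * hH
  rcases sq_eq_sq_iff_eq_or_eq_neg.mp hsq with h | h
  · exfalso
    obtain ⟨t, ht⟩ := hHe
    obtain ⟨v, hv⟩ := hN
    have h2 : e ∣ 2 := by
      refine ⟨q * v - 3 * ε * t - e * t * t, ?_⟩
      have : H = ε + e * t := by linarith
      subst this
      subst hv
      linear_combination -h - 2 * hε
    have := Int.le_of_dvd (by norm_num) h2
    omega
  · linarith

lemma card_filter_quad [Fintype F] [DecidableEq F] (hq : 2 ≤ q) (hu : 1 ≤ u) (hk : 1 ≤ k)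
    (hadd : ∀ x y : F, (x + y) ^ q = x ^ q + y ^ q) (hcard : Fintype.card F = q ^ (2 * u * k))
    (hker : ∀ z : F, z ≠ 0 →
      a ^ q ^ (u * (2 * i + 1)) * z ^ q ^ (2 * (u * (2 * i + 1))) + a * z ≠ 0)
    {s : F} (hs : s ^ q = s) :
    (q * #{x : F | frobTrace q (2 * u * k) (a * x ^ (q ^ (u * (2 * i + 1)) + 1)) = s} : ℤ) =
      if s = 0 then (q : ℤ) ^ (2 * u * k) + (-1) ^ k * (q : ℤ) ^ (u * k) * (q - 1)
      else (q : ℤ) ^ (2 * u * k) + (-1) ^ (k + 1) * (q : ℤ) ^ (u * k) := by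
  have hℓ : 1 ≤ 2 * u * k := Nat.mul_pos (by omega) hk
  obtain ⟨h₁, h₂⟩ := card_filter_quad_relations hq hℓ hadd hcard hker rfl
    (fun s hs hs0 => card_filter_quad_eq_one hq hu hk hcard hs hs0)
  have hdvd := dvd_card_filter_quad (ℓ := 2 * u * k) (a := a) (i := i) hq hu hk hcard
  have hfib := card_filter_quad_eq_one (ℓ := 2 * u * k) (a := a) (i := i) hq hu hk hcard hs
  generalize #{x : F | frobTrace q (2 * u * k) (a * x ^ (q ^ (u * (2 * i + 1)) + 1)) = 1} = N₁
    at h₁ h₂ hdvd hfib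
  have hqQ : (q : ℤ) * (q : ℤ) ^ (2 * u * k - 1) = (q : ℤ) ^ (2 * u * k) :=
    mul_pow_sub_one (by omega) _
  have hHH : (q : ℤ) ^ (2 * u * k) = (q : ℤ) ^ (u * k) * (q : ℤ) ^ (u * k) := by
    rw [← pow_add]; congr 1; ring
  have hle : 1 ≤ q ^ (2 * u * k) := Nat.one_le_pow _ _ (by omega)
  zify [hle, show 1 ≤ q by omega] at h₁ h₂ hdvd
  have hqu : (2 : ℤ) ≤ (q : ℤ) ^ u := by
    exact_mod_cast hq.trans (Nat.le_self_pow (by omega) q)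
  have key := mul_eq_of_moments (q := q) (Q := (q : ℤ) ^ (2 * u * k - 1)) (H := (q : ℤ) ^ (u * k))
    (e := (q : ℤ) ^ u + 1) (ε := (-1) ^ k) (by exact_mod_cast hq) (by linarith)
    (by rw [hqQ, hHH]) (by rw [← mul_pow]; simp)
    (by rw [pow_mul]; simpa using sub_dvd_pow_sub_pow ((q : ℤ) ^ u) (-1) k) hdvd
    (by rw [hqQ]; exact h₁) (by rw [hqQ]; exact h₂)
  split_ifs with h
  · subst h
    linear_combination (q : ℤ) * h₁ - ((q : ℤ) - 1) * key - ((q : ℤ) - 1) * hHH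
  · rw [hfib h, pow_succ]
    linear_combination key - hHH

end EvenQuotient

/-- Completing the square at a zero of the affine polar map. -/
lemma card_filter_complete_square [Fintype F] [DecidableEq F] {a b c x₀ : F} {r : ℕ}
    (hadd : ∀ x y : F, (x + y) ^ q = x ^ q + y ^ q) (hcard : Fintype.card F = q ^ ℓ)
    (hx₀ : a ^ q ^ r * x₀ ^ q ^ (2 * r) + a * x₀ = -(b ^ q ^ r)) :
    #{x : F | frobTrace q ℓ (a * x ^ (q ^ r + 1) + b * x + c) = 0} =
      #{x : F | frobTrace q ℓ (a * x ^ (q ^ r + 1)) =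
        frobTrace q ℓ (a * x₀ ^ (q ^ r + 1) - c)} := by
  refine (card_bijective _ (Equiv.addRight x₀).bijective fun x => ?_).symm
  simp only [mem_filter, mem_univ, true_and, Equiv.coe_addRight]
  have hb : ∀ y, frobTrace q ℓ (b * y) = - frobTrace q ℓ (y ^ q ^ r * -(b ^ q ^ r)) := fun y => by
    rw [← frobTrace_pow_pow hcard r (b * y), mul_pow, eq_neg_iff_add_eq_zero,
      ← frobTrace_add hadd]
    have h0 := frobTrace_add (ℓ := ℓ) hadd 0 0
    rw [add_zero] at h0
    rw [← left_eq_add.mp h0]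
    congr 1; ring
  have hself : frobTrace q ℓ (x₀ ^ q ^ r * -(b ^ q ^ r)) =
      2 * frobTrace q ℓ (a * x₀ ^ (q ^ r + 1)) := by
    rw [← hx₀, show x₀ ^ q ^ r * (a ^ q ^ r * x₀ ^ q ^ (2 * r) + a * x₀) =
      (a * x₀ ^ (q ^ r + 1)) ^ q ^ r + a * x₀ ^ (q ^ r + 1) by
        rw [mul_pow, ← pow_mul, two_mul, pow_add q]; ring,
      frobTrace_add hadd, frobTrace_pow_pow hcard]
    ring
  have hc := frobTrace_add (ℓ := ℓ) hadd (a * x₀ ^ (q ^ r + 1) - c) c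
  rw [sub_add_cancel] at hc
  rw [frobTrace_add hadd, frobTrace_add hadd, frobTrace_quad_add hadd hcard, hx₀, hb (x + x₀),
    add_pow_pow hadd, add_mul, frobTrace_add hadd (x ^ q ^ r * _), hself]
  constructor <;> intro h
  · linear_combination h - hc
  · linear_combination h + hc

/-- The number of points of `y ^ q - y = g x` through the trace of `g`. -/
lemma card_artinSchreier [Fintype F] [DecidableEq F] (hq : 2 ≤ q) (hℓ : 1 ≤ ℓ)
    (hadd : ∀ x y : F, (x + y) ^ q = x ^ q + y ^ q) (hcard : Fintype.card F = q ^ ℓ) (g : F → F) :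
    Nat.card {xy : F × F // xy.2 ^ q - xy.2 = g xy.1} =
      q * #{x : F | frobTrace q ℓ (g x) = 0} := by
  rw [Nat.card_eq_fintype_card, Fintype.card_subtype, card_filter, Fintype.sum_prod_type]
  simp only [← card_filter, card_filter_pow_sub_eq hq hℓ hadd hcard]
  rw [← sum_filter, sum_const, smul_eq_mul, mul_comm]

end FiniteField

/-- Let `p` be prime, `q = p ^ n`, and `ℓ ≥ 2`, `r ≥ 1` with `ℓ / u` even,
`u = gcd(ℓ, r)`.  Let `a, b, c ∈ F_{q^ℓ}` with `a ≠ 0` and `f(x) = a^(q^r) x^(q^(2r)) + a x`.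
If `f` is a permutation polynomial of `F_{q^ℓ}` and `x₀` is the solution of
`f(x) = -b^(q^r)`, with `c₁ = a x₀^(q^r+1) - c`, then
`N_{ℓ,r}(a,b,c) = q^ℓ + (-1)^(ℓ/2u) q^(ℓ/2) (q-1)` if `T(c₁) = 0` and
`N_{ℓ,r}(a,b,c) = q^ℓ + (-1)^(ℓ/2u + 1) q^(ℓ/2)` if `T(c₁) ≠ 0`. -/
theorem stmt_9 (p n : ℕ) (hp : p.Prime) (hn : 1 ≤ n) (q : ℕ) (hq : q = p ^ n)
    (ℓ r : ℕ) (hℓ : 2 ≤ ℓ) (hr : 1 ≤ r)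
    (u : ℕ) (hu : u = Nat.gcd ℓ r) (heven : Even (ℓ / u))
    (F : Type) [Field F] [Fintype F] (hF : Fintype.card F = q ^ ℓ)
    (T : F → F) (hT : ∀ z : F, T z = ∑ i ∈ Finset.range ℓ, z ^ q ^ i)
    (a b c x₀ c₁ : F) (ha : a ≠ 0)
    (hperm : Function.Bijective (fun x : F => a ^ q ^ r * x ^ q ^ (2 * r) + a * x))
    (hx₀ : a ^ q ^ r * x₀ ^ q ^ (2 * r) + a * x₀ = -(b ^ q ^ r))
    (hc₁ : c₁ = a * x₀ ^ (q ^ r + 1) - c) :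
    (T c₁ = 0 →
      (Nat.card {xy : F × F //
          xy.2 ^ q - xy.2 = a * xy.1 ^ (q ^ r + 1) + b * xy.1 + c} : ℤ)
        = (q : ℤ) ^ ℓ + (-1 : ℤ) ^ (ℓ / (2 * u)) * (q : ℤ) ^ (ℓ / 2) * ((q : ℤ) - 1)) ∧
    (T c₁ ≠ 0 →
      (Nat.card {xy : F × F //
          xy.2 ^ q - xy.2 = a * xy.1 ^ (q ^ r + 1) + b * xy.1 + c} : ℤ)
        = (q : ℤ) ^ ℓ + (-1 : ℤ) ^ (ℓ / (2 * u) + 1) * (q : ℤ) ^ (ℓ / 2)) := by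
  classical
  subst hc₁
  have : Fact p.Prime := ⟨hp⟩
  have : CharP F p := charP_of_card_eq_prime_pow (f := n * ℓ) (by rw [hF, hq, pow_mul])
  have hadd : ∀ x y : F, (x + y) ^ q = x ^ q + y ^ q := fun x y => by
    rw [hq, add_pow_expChar_pow]
  have hq2 : 2 ≤ q := hq ▸ hp.two_le.trans (Nat.le_self_pow (by omega) p)
  have hupos : 1 ≤ u := hu ▸ Nat.gcd_pos_of_pos_right ℓ (by omega)
  have hcop : Nat.Coprime (ℓ / u) (r / u) := hu ▸ Nat.coprime_div_gcd_div_gcd (hu ▸ hupos)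
  have hrodd : Odd (r / u) := by
    rw [← Nat.not_even_iff_odd]
    intro h
    exact Nat.not_coprime_of_dvd_of_dvd one_lt_two heven.two_dvd h.two_dvd hcop
  obtain ⟨i, hi⟩ := hrodd
  obtain ⟨k, hk⟩ := heven.two_dvd
  have hr' : r = u * (2 * i + 1) := by
    rw [← hi, Nat.mul_div_cancel' (hu ▸ Nat.gcd_dvd_right ℓ r)]
  have hℓ' : ℓ = 2 * u * k := by
    rw [mul_assoc, mul_left_comm, ← hk, Nat.mul_div_cancel' (hu ▸ Nat.gcd_dvd_left ℓ r)]
  clear hu hi hk hcop heven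
  have hkpos : 1 ≤ k := by
    rcases Nat.eq_zero_or_pos k with rfl | h
    · omega
    · exact h
  have hTeq : ∀ z, T z = frobTrace q ℓ z := hT
  have hker : ∀ z : F, z ≠ 0 → a ^ q ^ r * z ^ q ^ (2 * r) + a * z ≠ 0 := fun z hz h =>
    hz (hperm.injective (by simpa [show q ≠ 0 by omega] using h))
  have hcount := card_artinSchreier hq2 (by omega) hadd hF
    (fun x => a * x ^ (q ^ r + 1) + b * x + c)
  rw [card_filter_complete_square hadd hF hx₀] at hcount
  subst hr' hℓ'
  have hmain := card_filter_quad hq2 hupos hkpos hadd hF hker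
    (frobTrace_pow_self hq2 hadd hF (a * x₀ ^ (q ^ (u * (2 * i + 1)) + 1) - c))
  have hk1 : 2 * u * k / (2 * u) = k := Nat.mul_div_cancel_left k (by omega)
  have hk2 : 2 * u * k / 2 = u * k := by rw [mul_assoc, Nat.mul_div_cancel_left _ two_pos]
  rw [hTeq, hk1, hk2, hcount, Nat.cast_mul, hmain]
  exact ⟨fun h => if_pos h, fun h => if_neg h⟩
end
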